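/- arXiv:1309.1970 — 2 statements merged into one kernel-verified Lean document; each statement's English description precedes it below -/
import Mathlib

section
/- Let A0, A1, …, Am be skew-Hermitian n×n complex matrices. Write the eigenvalues of A0 as i·λ1, …, i·λn with λ1,…,λn real, repeated according to multiplicity, and let φ1,…,φn be an orthonormal basis of ℂ^n of associated eigenvectors. Let S0 = {(j,k) ∈ {1,…,n}² : there exists l ∈ {1,…,m} with ⟨φj, Al φk⟩ ≠ 0}. Assume there exists S ⊆ S0 such that the graph with vertices 1,…,n and edge set S is connected, and that for every (j,k) ∈ S and every (r,s) ∈ S0 with (r,s) ≠ (j,k) one has λj − λk ≠ λr − λs. Then the real Lie algebra generated by A0, A1, …, Am equals su(n) if all of A0,…,Am have zero trace, and equals u(n) otherwise. -/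
open scoped BigOperators ComplexOrder
open Matrix

attribute [local instance 100] LieRing.ofAssociativeRing

section Helpers

variable {n : ℕ}

lemma lgc_bracket (A B : Matrix (Fin n) (Fin n) ℂ) : ⁅A, B⁆ = A * B - B * A := rfl

/-- The elementary skew-Hermitian matrix. -/
noncomputable def lgcX (j k : Fin n) (z : ℂ) : Matrix (Fin n) (Fin n) ℂ :=
  Matrix.single j k z - Matrix.single k j (star z)

lemma lgc_diag_bracket (lam : Fin n → ℝ) (M : Matrix (Fin n) (Fin n) ℂ) (r s : Fin n) :
    (⁅Matrix.diagonal (fun j => Complex.I * (lam j : ℂ)), M⁆ : Matrix (Fin n) (Fin n) ℂ) r s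
      = Complex.I * ((lam r - lam s : ℝ) : ℂ) * M r s := by
  rw [lgc_bracket, Matrix.sub_apply, Matrix.diagonal_mul, Matrix.mul_diagonal]
  push_cast
  ring

lemma lgc_filter (L : LieSubalgebra ℝ (Matrix (Fin n) (Fin n) ℂ)) (lam : Fin n → ℝ)
    (hD : Matrix.diagonal (fun j => Complex.I * (lam j : ℂ)) ∈ L)
    (M : Matrix (Fin n) (Fin n) ℂ) (hM : M ∈ L) (V : Finset ℝ) :
    (Matrix.of fun r s => ((∏ v ∈ V, (v - (lam r - lam s) ^ 2) : ℝ) : ℂ) * M r s) ∈ L := by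
  induction V using Finset.induction_on with
  | empty =>
    convert hM using 1
    ext r s
    simp
  | insert a V ha ih =>
    set N : Matrix (Fin n) (Fin n) ℂ :=
      Matrix.of fun r s => ((∏ v ∈ V, (v - (lam r - lam s) ^ 2) : ℝ) : ℂ) * M r s with hN
    have h2 := L.add_mem (L.smul_mem a ih) (L.lie_mem hD (L.lie_mem hD ih))
    convert h2 using 1
    ext r s
    rw [Matrix.add_apply, lgc_diag_bracket, lgc_diag_bracket, Matrix.smul_apply, Matrix.of_apply,
      Finset.prod_insert ha, hN, Matrix.of_apply, Complex.real_smul]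
    push_cast
    linear_combination (-((lam r : ℂ) - lam s) ^ 2 * (∏ v ∈ V, ((v : ℂ) - ((lam r : ℂ) - lam s) ^ 2)) * M r s) * Complex.I_sq

lemma lgc_X_symm (j k : Fin n) (z : ℂ) : lgcX k j z = lgcX j k (-star z) := by
  ext r s
  simp [lgcX, Matrix.single_apply]
  split_ifs <;> ring

lemma lgc_X_trans (j k l : Fin n) (hjk : j ≠ k) (hkl : k ≠ l) (hjl : j ≠ l) (z : ℂ) :
    ⁅lgcX j k z, lgcX k l 1⁆ = lgcX j l z := by
  simp [lgc_bracket, lgcX, sub_mul, mul_sub, hjk, hkl, hjl, hjk.symm, hkl.symm, hjl.symm]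

lemma lgc_X_diag (j k : Fin n) (hjk : j ≠ k) :
    ⁅lgcX j k 1, lgcX j k Complex.I⁆ =
      (2 : ℝ) • (Matrix.single j j Complex.I - Matrix.single k k Complex.I) := by
  simp [lgc_bracket, lgcX, sub_mul, mul_sub, hjk, hjk.symm, two_smul, ← Matrix.single_neg]

lemma lgc_X_smul (j k : Fin n) (z : ℂ) (t : ℝ) : t • lgcX j k z = lgcX j k (t * z) := by
  simp [lgcX, smul_sub, Matrix.smul_single]

lemma lgc_X_add (j k : Fin n) (z w : ℂ) : lgcX j k z + lgcX j k w = lgcX j k (z + w) := by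
  simp [lgcX, Matrix.single_add]
  abel

lemma lgc_edge {m : ℕ} (L : LieSubalgebra ℝ (Matrix (Fin n) (Fin n) ℂ)) (lam : Fin n → ℝ)
    (hD : Matrix.diagonal (fun j => Complex.I * (lam j : ℂ)) ∈ L)
    (Bs : Fin m → Matrix (Fin n) (Fin n) ℂ) (hBs : ∀ l, (Bs l)ᴴ = -(Bs l))
    (hB : ∀ l, Bs l ∈ L) (j k : Fin n) (hjk : j ≠ k)
    (h0 : ∃ l, Bs l j k ≠ 0)
    (hgap : ∀ q : Fin n × Fin n, (∃ l, Bs l q.1 q.2 ≠ 0) → q ≠ (j, k) →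
      lam j - lam k ≠ lam q.1 - lam q.2) (z : ℂ) : lgcX j k z ∈ L := by
  have hsk : ∀ l r s, Bs l s r = - star (Bs l r s) := by
    intro l r s
    have := congrFun (congrFun (hBs l) s) r
    rw [Matrix.conjTranspose_apply, Matrix.neg_apply] at this
    rw [this, neg_neg]
  have hsym : ∀ r s, (∃ l, Bs l r s ≠ 0) → ∃ l, Bs l s r ≠ 0 := by
    rintro r s ⟨l, hl⟩
    refine ⟨l, ?_⟩
    rw [hsk l r s]
    simpa using hl
  obtain ⟨l, hl⟩ := h0
  have hg : lam j - lam k ≠ 0 := by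
    have := hgap (k, j) (hsym j k ⟨l, hl⟩) (by simp [hjk.symm])
    intro h
    apply this
    simp only
    linarith
  classical
  set V : Finset ℝ := (Finset.univ.image
    (fun p : Fin n × Fin n => (lam p.1 - lam p.2) ^ 2)).erase ((lam j - lam k) ^ 2) with hV
  have hmem := lgc_filter L lam hD (Bs l) (hB l) V
  set c : ℝ := ∏ v ∈ V, (v - (lam j - lam k) ^ 2) with hc
  have hc0 : c ≠ 0 := by
    rw [hc, Finset.prod_ne_zero_iff]
    intro v hv
    rw [sub_ne_zero]
    exact Finset.ne_of_mem_erase hv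
  have hX : lgcX j k (c * Bs l j k) ∈ L := by
    convert hmem using 1
    ext r s
    rw [Matrix.of_apply]
    by_cases h1 : r = j ∧ s = k
    · obtain ⟨rfl, rfl⟩ := h1
      simp [lgcX, Matrix.single_apply, hjk, hjk.symm, hc]
    by_cases h2 : r = k ∧ s = j
    · obtain ⟨rfl, rfl⟩ := h2
      have e : ∏ v ∈ V, (v - (lam r - lam s) ^ 2) = c := by
        rw [hc]
        refine Finset.prod_congr rfl fun v _ => ?_
        ring
      rw [e, hsk l s r]
      simp [lgcX, Matrix.single_apply, hjk, hjk.symm]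
    have hz : lgcX j k (c * Bs l j k) r s = 0 := by
      rw [lgcX, Matrix.sub_apply, Matrix.single_apply_of_ne _ _ _ _ _ (by tauto),
        Matrix.single_apply_of_ne _ _ _ _ _ (by tauto), sub_zero]
    rw [hz, eq_comm]
    by_cases hb : Bs l r s = 0
    · simp [hb]
    have hne : (lam r - lam s) ^ 2 ≠ (lam j - lam k) ^ 2 := by
      intro h
      rcases sq_eq_sq_iff_eq_or_eq_neg.mp h with h | h
      · exact hgap (r, s) ⟨l, hb⟩ (by simp only [ne_eq, Prod.mk.injEq]; exact h1) h.symm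
      · refine hgap (s, r) (hsym r s ⟨l, hb⟩)
          (by simp only [ne_eq, Prod.mk.injEq]; tauto) ?_
        simp only
        linarith
    have : ∏ v ∈ V, (v - (lam r - lam s) ^ 2) = 0 := by
      refine Finset.prod_eq_zero (i := (lam r - lam s) ^ 2) ?_ (sub_self ((lam r - lam s) ^ 2))
      rw [hV, Finset.mem_erase]
      exact ⟨hne, Finset.mem_image.mpr ⟨(r, s), Finset.mem_univ _, rfl⟩⟩
    rw [this]
    simp
  set b : ℂ := c * Bs l j k with hb
  have hb0 : b ≠ 0 := mul_ne_zero (by exact_mod_cast hc0) hl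
  have hX2 : lgcX j k (((lam j - lam k : ℝ) : ℂ) * (Complex.I * b)) ∈ L := by
    convert L.lie_mem hD hX using 1
    ext r s
    rw [lgc_diag_bracket]
    simp only [lgcX, Matrix.sub_apply, Matrix.single_apply]
    by_cases h1 : r = j ∧ s = k
    · obtain ⟨rfl, rfl⟩ := h1
      simp [hjk, hjk.symm]
      ring
    by_cases h2 : r = k ∧ s = j
    · obtain ⟨rfl, rfl⟩ := h2
      simp [hjk, hjk.symm]
      ring
    rw [if_neg (by tauto), if_neg (by tauto), if_neg (by tauto), if_neg (by tauto)]
    simp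
  rw [← lgc_X_smul] at hX2
  have hX3 : lgcX j k (Complex.I * b) ∈ L := by
    have := L.smul_mem (lam j - lam k)⁻¹ hX2
    rwa [smul_smul, inv_mul_cancel₀ hg, one_smul] at this
  have := L.add_mem (L.smul_mem (z / b).re hX) (L.smul_mem (z / b).im hX3)
  rw [lgc_X_smul, lgc_X_smul, lgc_X_add] at this
  convert this using 2
  calc z = (z / b) * b := by field_simp
    _ = (((z / b).re : ℂ) + (z / b).im * Complex.I) * b := by rw [Complex.re_add_im]
    _ = _ := by ring

lemma lgc_core {m : ℕ} (L : LieSubalgebra ℝ (Matrix (Fin n) (Fin n) ℂ)) (lam : Fin n → ℝ)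
    (hD : Matrix.diagonal (fun j => Complex.I * (lam j : ℂ)) ∈ L)
    (Bs : Fin m → Matrix (Fin n) (Fin n) ℂ) (hBs : ∀ l, (Bs l)ᴴ = -(Bs l))
    (hB : ∀ l, Bs l ∈ L) (S : Set (Fin n × Fin n))
    (hS : ∀ p ∈ S, ∃ l, Bs l p.1 p.2 ≠ 0)
    (hconn : (SimpleGraph.fromRel (fun a b => (a, b) ∈ S)).Connected)
    (hgap : ∀ p ∈ S, ∀ q : Fin n × Fin n, (∃ l, Bs l q.1 q.2 ≠ 0) → q ≠ p →
      lam p.1 - lam p.2 ≠ lam q.1 - lam q.2)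
    (M : Matrix (Fin n) (Fin n) ℂ) (hM : Mᴴ = -M) (htr : M.trace = 0) : M ∈ L := by
  have hS' : ∀ j k, j ≠ k → (j, k) ∈ S → ∀ z, lgcX j k z ∈ L := fun j k hjk h z =>
    lgc_edge L lam hD Bs hBs hB j k hjk (hS _ h) (hgap _ h) z
  have hadj : ∀ j k, (SimpleGraph.fromRel (fun a b => (a, b) ∈ S)).Adj j k →
      ∀ z, lgcX j k z ∈ L := by
    intro j k h z
    rw [SimpleGraph.fromRel_adj] at h
    obtain ⟨hne, h | h⟩ := h
    · exact hS' j k hne h z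
    · rw [lgc_X_symm]
      exact hS' k j hne.symm h _
  have hall : ∀ j k, j ≠ k → ∀ z, lgcX j k z ∈ L := by
    intro j k
    obtain ⟨w⟩ := hconn.preconnected j k
    induction w with
    | nil => intro h; exact absurd rfl h
    | @cons a b d hab w ih =>
      intro had z
      by_cases hbd : b = d
      · subst hbd
        exact hadj _ _ hab z
      · rw [← lgc_X_trans a b d hab.ne hbd had]
        exact L.lie_mem (hadj _ _ hab z) (ih hbd 1)
  obtain ⟨o⟩ := hconn.nonempty
  have hsk : ∀ r s, star (M s r) = - M r s := by
    intro r s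
    have := congrFun (congrFun hM r) s
    rwa [Matrix.conjTranspose_apply, Matrix.neg_apply] at this
  have hdg : ∀ j, Matrix.single j j (M j j) - Matrix.single o o (M j j) ∈ L := by
    intro j
    by_cases hj : j = o
    · subst hj
      rw [sub_self]
      exact L.zero_mem
    have h1 := L.smul_mem (M j j).im (L.smul_mem (2 : ℝ)⁻¹
      (L.lie_mem (hall j o hj 1) (hall j o hj Complex.I)))
    rw [lgc_X_diag j o hj, smul_smul 2⁻¹, inv_mul_cancel₀ two_ne_zero, one_smul, smul_sub,
      Matrix.smul_single, Matrix.smul_single] at h1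
    have e : M j j = (M j j).im • Complex.I := by
      have h2 := hsk j j
      have h3 := congrArg Complex.re h2
      simp at h3
      apply Complex.ext
      · simp; linarith
      · simp
    rw [← e] at h1
    exact h1
  have hdiag : ∑ j, (Matrix.single j j (M j j) - Matrix.single o o (M j j)) ∈ L :=
    sum_mem fun j _ => hdg j
  have hoff : (2 : ℝ)⁻¹ • ∑ j, ∑ k, (if j = k then 0 else lgcX j k (M j k)) ∈ L := by
    refine L.smul_mem _ (sum_mem fun j _ => sum_mem fun k _ => ?_)
    split_ifs with h
    · exact L.zero_mem
    · exact hall j k h _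
  convert L.add_mem hdiag hoff using 1
  have e1 : ∑ j, (Matrix.single j j (M j j) - Matrix.single o o (M j j)) =
      ∑ j, Matrix.single j j (M j j) := by
    have : ∑ j, Matrix.single o o (M j j) = (0 : Matrix (Fin n) (Fin n) ℂ) := by
      ext r s
      rw [Matrix.sum_apply]
      simp only [Matrix.single_apply]
      split_ifs
      · exact htr
      · simp
    rw [Finset.sum_sub_distrib, this, sub_zero]
  rw [e1]
  have e2 : ∀ j k, (if j = k then 0 else lgcX j k (M j k)) =
      (Matrix.single j k (M j k) + Matrix.single k j (M k j)) -
        (if j = k then (2 : ℝ) • Matrix.single j j (M j j) else 0) := by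
    intro j k
    split_ifs with h
    · subst h
      rw [two_smul, sub_self]
    · rw [lgcX, hsk, ← Matrix.single_neg]
      abel
  simp only [e2, Finset.sum_sub_distrib, Finset.sum_add_distrib]
  have e3 : ∑ j, ∑ k, Matrix.single j k (M j k) = M := (Matrix.matrix_eq_sum_single M).symm
  have e4 : ∑ j, ∑ k, Matrix.single k j (M k j) = M := by
    rw [Finset.sum_comm]
    exact e3
  rw [e3, e4]
  simp only [Finset.sum_ite_eq, Finset.mem_univ, if_true]
  rw [← Finset.smul_sum, ← two_smul ℝ M, ← smul_sub, smul_smul, inv_mul_cancel₀ two_ne_zero,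
    one_smul]
  abel

/-- Conjugation by a unitary, as a real Lie algebra map. -/
def lgcConj (U : Matrix (Fin n) (Fin n) ℂ) (hU : Uᴴ * U = 1) :
    Matrix (Fin n) (Fin n) ℂ →ₗ⁅ℝ⁆ Matrix (Fin n) (Fin n) ℂ where
  toFun M := U * M * Uᴴ
  map_add' M N := by rw [mul_add, add_mul]
  map_smul' t M := by simp
  map_lie' := by
    intro M N
    have h : ∀ M N : Matrix (Fin n) (Fin n) ℂ, U * M * Uᴴ * (U * N * Uᴴ) = U * (M * N) * Uᴴ := by
      intro M N
      calc U * M * Uᴴ * (U * N * Uᴴ) = U * M * (Uᴴ * U) * N * Uᴴ := by simp only [mul_assoc]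
        _ = _ := by rw [hU, mul_one]; simp only [mul_assoc]
    show U * (M * N - N * M) * Uᴴ = U * M * Uᴴ * (U * N * Uᴴ) - U * N * Uᴴ * (U * M * Uᴴ)
    rw [h, h, mul_sub, sub_mul]

/-- The skew-Hermitian matrices. -/
def lgcU (n : ℕ) : LieSubalgebra ℝ (Matrix (Fin n) (Fin n) ℂ) where
  carrier := {A | Aᴴ = -A}
  add_mem' := by
    intro A B hA hB
    simp only [Set.mem_setOf_eq] at *
    rw [Matrix.conjTranspose_add, hA, hB, neg_add]
  zero_mem' := by simp
  smul_mem' := by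
    intro t A hA
    simp only [Set.mem_setOf_eq] at *
    rw [Matrix.conjTranspose_smul, hA]
    simp
  lie_mem' := by
    intro A B hA hB
    simp only [Set.mem_setOf_eq, AddSubsemigroup.mem_carrier] at *
    change Aᴴ = -A at hA
    change Bᴴ = -B at hB
    show (A * B - B * A)ᴴ = -(A * B - B * A)
    rw [Matrix.conjTranspose_sub, Matrix.conjTranspose_mul, Matrix.conjTranspose_mul, hA, hB]
    simp

/-- The traceless skew-Hermitian matrices. -/
def lgcSU (n : ℕ) : LieSubalgebra ℝ (Matrix (Fin n) (Fin n) ℂ) where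
  carrier := {A | Aᴴ = -A ∧ A.trace = 0}
  add_mem' := by
    rintro A B ⟨hA, hA'⟩ ⟨hB, hB'⟩
    exact ⟨(lgcU n).add_mem hA hB, by rw [Matrix.trace_add, hA', hB', add_zero]⟩
  zero_mem' := by simp
  smul_mem' := by
    rintro t A ⟨hA, hA'⟩
    exact ⟨(lgcU n).smul_mem t hA, by rw [Matrix.trace_smul, hA', smul_zero]⟩
  lie_mem' := by
    rintro A B ⟨hA, hA'⟩ ⟨hB, hB'⟩
    refine ⟨(lgcU n).lie_mem hA hB, ?_⟩
    show (A * B - B * A).trace = 0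
    rw [Matrix.trace_sub, Matrix.trace_mul_comm, sub_self]

lemma lgc_inner (φ : Fin n → EuclideanSpace ℂ (Fin n)) (A : Matrix (Fin n) (Fin n) ℂ)
    (j k : Fin n) :
    ((Matrix.of fun i j => φ j i)ᴴ * A * (Matrix.of fun i j => φ j i)) j k =
      inner ℂ (φ j) (Matrix.toEuclideanLin A (φ k)) := by
  rw [mul_assoc, Matrix.mul_apply, PiLp.inner_apply]
  refine Finset.sum_congr rfl fun i _ => ?_
  simp [Matrix.conjTranspose_apply, Matrix.mul_apply, Matrix.toEuclideanLin, Matrix.mulVec,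
    dotProduct, mul_comm]

lemma lgc_su_le {m : ℕ}
    (A0 : Matrix (Fin n) (Fin n) ℂ) (As : Fin m → Matrix (Fin n) (Fin n) ℂ)
    (hAs : ∀ l, (As l)ᴴ = -(As l))
    (lam : Fin n → ℝ) (φ : Fin n → EuclideanSpace ℂ (Fin n))
    (hortho : Orthonormal ℂ φ)
    (heig : ∀ j, Matrix.toEuclideanLin A0 (φ j) = (Complex.I * (lam j : ℂ)) • φ j)
    (S : Set (Fin n × Fin n))
    (hS : S ⊆ {p : Fin n × Fin n |
      ∃ l, inner ℂ (φ p.1) (Matrix.toEuclideanLin (As l) (φ p.2)) ≠ (0 : ℂ)})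
    (hconn : (SimpleGraph.fromRel (fun a b => (a, b) ∈ S)).Connected)
    (hgap : ∀ p ∈ S,
      ∀ q ∈ {p : Fin n × Fin n |
        ∃ l, inner ℂ (φ p.1) (Matrix.toEuclideanLin (As l) (φ p.2)) ≠ (0 : ℂ)},
      q ≠ p → lam p.1 - lam p.2 ≠ lam q.1 - lam q.2)
    (L : LieSubalgebra ℝ (Matrix (Fin n) (Fin n) ℂ)) (h0 : A0 ∈ L) (hl : ∀ l, As l ∈ L)
    (M : Matrix (Fin n) (Fin n) ℂ) (hM : Mᴴ = -M) (htr : M.trace = 0) : M ∈ L := by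
  set U : Matrix (Fin n) (Fin n) ℂ := Matrix.of fun i j => φ j i with hUdef
  have hU : Uᴴ * U = 1 := by
    ext j k
    have := lgc_inner φ 1 j k
    rw [mul_one] at this
    rw [this, Matrix.toEuclideanLin, Matrix.one_apply]
    have h2 := orthonormal_iff_ite.mp hortho j k
    simpa using h2
  have hU' : U * Uᴴ = 1 := mul_eq_one_comm.mp hU
  have hcc : ∀ A, U * (Uᴴ * A * U) * Uᴴ = A := by
    intro A
    calc U * (Uᴴ * A * U) * Uᴴ = (U * Uᴴ) * A * (U * Uᴴ) := by simp only [mul_assoc]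
      _ = A := by rw [hU', one_mul, mul_one]
  have hskew : ∀ A : Matrix (Fin n) (Fin n) ℂ, Aᴴ = -A → (Uᴴ * A * U)ᴴ = -(Uᴴ * A * U) := by
    intro A hA
    rw [Matrix.conjTranspose_mul, Matrix.conjTranspose_mul, hA, Matrix.conjTranspose_conjTranspose]
    simp [mul_assoc]
  have hmem : ∀ A, Uᴴ * A * U ∈ L.comap (lgcConj U hU) ↔ A ∈ L := by
    intro A
    rw [LieSubalgebra.mem_comap]
    show U * (Uᴴ * A * U) * Uᴴ ∈ L ↔ A ∈ L
    rw [hcc]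
  have hD : Matrix.diagonal (fun j => Complex.I * (lam j : ℂ)) = Uᴴ * A0 * U := by
    ext j k
    rw [lgc_inner, heig, inner_smul_right, orthonormal_iff_ite.mp hortho, Matrix.diagonal_apply]
    by_cases h : j = k
    · subst h; simp
    · simp [h]
  rw [← hmem]
  refine lgc_core _ lam ?_ (fun l => Uᴴ * As l * U) (fun l => hskew _ (hAs l))
    (fun l => (hmem _).mpr (hl l)) S ?_ hconn ?_ _ (hskew M hM) ?_
  · rw [hD]
    exact (hmem _).mpr h0
  · intro p hp
    obtain ⟨l, h⟩ := hS hp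
    exact ⟨l, by rw [lgc_inner]; exact h⟩
  · rintro p hp q ⟨l, h⟩ hqp
    rw [lgc_inner] at h
    exact hgap p hp q ⟨l, h⟩ hqp
  · rw [Matrix.trace_mul_comm, ← mul_assoc, hU', one_mul, htr]

lemma lgc_trace_re (A : Matrix (Fin n) (Fin n) ℂ) (hA : Aᴴ = -A) : A.trace.re = 0 := by
  have h := congrArg Matrix.trace hA
  rw [Matrix.trace_conjTranspose, Matrix.trace_neg] at h
  have h3 := congrArg Complex.re h
  simp at h3
  linarith

lemma lgc_u_le (L : LieSubalgebra ℝ (Matrix (Fin n) (Fin n) ℂ))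
    (hL : ∀ M : Matrix (Fin n) (Fin n) ℂ, Mᴴ = -M → M.trace = 0 → M ∈ L)
    (C : Matrix (Fin n) (Fin n) ℂ) (hC : C ∈ L) (hC' : Cᴴ = -C) (htr : C.trace ≠ 0)
    (M : Matrix (Fin n) (Fin n) ℂ) (hM : Mᴴ = -M) : M ∈ L := by
  have h1 := lgc_trace_re C hC'
  have h2 := lgc_trace_re M hM
  have h3 : C.trace.im ≠ 0 := fun h => htr (Complex.ext h1 h)
  set t : ℝ := M.trace.im / C.trace.im with ht
  have h4 : M - t • C ∈ L := by
    apply hL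
    · exact (lgcU n).sub_mem hM ((lgcU n).smul_mem t hC')
    · rw [Matrix.trace_sub, Matrix.trace_smul]
      apply Complex.ext
      · simp [h1, h2]
      · simp [ht, h3]
  have := L.add_mem h4 (L.smul_mem t hC)
  rwa [sub_add_cancel] at this

end Helpers

/-- Proposition 2.11 of the paper. Let `A0, A1, …, Am` be
skew-Hermitian matrices, let `i·λ 0, …, i·λ (n-1)` be the eigenvalues of `A0` (with
multiplicity) with associated orthonormal basis of eigenvectors `φ`, and let
`S0` be the set of pairs coupled by some controlled matrix `A l`.  If some `S ⊆ S0`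
makes the graph on `{0,…,n-1}` connected and the spectral gaps attached to edges of `S`
are different from all the other spectral gaps attached to elements of `S0`, then the
real Lie algebra generated by `A0, A1, …, Am` is `su(n)` if all of them are traceless,
and `u(n)` otherwise. -/
theorem lie_algebra_generation_criterion {n m : ℕ}
    (A0 : Matrix (Fin n) (Fin n) ℂ) (As : Fin m → Matrix (Fin n) (Fin n) ℂ)
    (hA0 : A0ᴴ = -A0) (hAs : ∀ l, (As l)ᴴ = -(As l))
    (lam : Fin n → ℝ) (φ : Fin n → EuclideanSpace ℂ (Fin n))
    (hortho : Orthonormal ℂ φ)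
    (heig : ∀ j, Matrix.toEuclideanLin A0 (φ j) = (Complex.I * (lam j : ℂ)) • φ j)
    (S : Set (Fin n × Fin n))
    (hS : S ⊆ {p : Fin n × Fin n |
      ∃ l, inner ℂ (φ p.1) (Matrix.toEuclideanLin (As l) (φ p.2)) ≠ (0 : ℂ)})
    (hconn : (SimpleGraph.fromRel (fun a b => (a, b) ∈ S)).Connected)
    (hgap : ∀ p ∈ S,
      ∀ q ∈ {p : Fin n × Fin n |
        ∃ l, inner ℂ (φ p.1) (Matrix.toEuclideanLin (As l) (φ p.2)) ≠ (0 : ℂ)},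
      q ≠ p → lam p.1 - lam p.2 ≠ lam q.1 - lam q.2) :
    ((A0.trace = 0 ∧ ∀ l, (As l).trace = 0) →
      (LieSubalgebra.lieSpan ℝ (Matrix (Fin n) (Fin n) ℂ)
          (insert A0 (Set.range As)) : Set (Matrix (Fin n) (Fin n) ℂ)) =
        {A | Aᴴ = -A ∧ A.trace = 0}) ∧
    (¬ (A0.trace = 0 ∧ ∀ l, (As l).trace = 0) →
      (LieSubalgebra.lieSpan ℝ (Matrix (Fin n) (Fin n) ℂ)
          (insert A0 (Set.range As)) : Set (Matrix (Fin n) (Fin n) ℂ)) =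
        {A | Aᴴ = -A}) := by
  set L := LieSubalgebra.lieSpan ℝ (Matrix (Fin n) (Fin n) ℂ) (insert A0 (Set.range As)) with hL
  have h0 : A0 ∈ L := LieSubalgebra.subset_lieSpan (Set.mem_insert _ _)
  have hl : ∀ l, As l ∈ L := fun l =>
    LieSubalgebra.subset_lieSpan (Set.mem_insert_of_mem _ ⟨l, rfl⟩)
  have hsu := lgc_su_le A0 As hAs lam φ hortho heig S hS hconn hgap L h0 hl
  constructor
  · rintro ⟨ht0, htl⟩
    apply Set.Subset.antisymm
    · have : L ≤ lgcSU n := by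
        rw [hL, LieSubalgebra.lieSpan_le]
        rintro _ (rfl | ⟨l, rfl⟩)
        · exact ⟨hA0, ht0⟩
        · exact ⟨hAs l, htl l⟩
      exact this
    · rintro M ⟨h1, h2⟩
      exact hsu M h1 h2
  · intro hne
    apply Set.Subset.antisymm
    · have : L ≤ lgcU n := by
        rw [hL, LieSubalgebra.lieSpan_le]
        rintro _ (rfl | ⟨l, rfl⟩)
        · exact hA0
        · exact hAs l
      exact this
    · intro M hM
      by_cases ht0 : A0.trace = 0
      · have : ∃ l, (As l).trace ≠ 0 := by
          by_contra hcon
          push Not at hcon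
          exact hne ⟨ht0, hcon⟩
        obtain ⟨l, htl⟩ := this
        exact lgc_u_le L hsu (As l) (hl l) (hAs l) htl M hM
      · exact lgc_u_le L hsu A0 h0 hA0 ht0 M hM
end

section
/- Assume m ≥ 2, n ≥ 2, U ⊆ ℝ^m open and connected, H(u) = H0 + u1·H1 + ⋯ + um·Hm with H0,…,Hm Hermitian n×n complex matrices, and that the spectrum of H(·) is conically connected. Then the real Lie algebra generated by {i·H(u) : u ∈ U} equals su(n) if all of H0, H1, …, Hm have zero trace, and equals u(n) otherwise. -/
open scoped BigOperators

attribute [local instance 100] LieRing.ofAssociativeRing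

/-- The control-affine Hamiltonian `H(u) = H0 + u 1 • H1 + ⋯ + u m • Hm`. -/
noncomputable def controlHam {n m : ℕ} (H0 : Matrix (Fin n) (Fin n) ℂ)
    (Hc : Fin m → Matrix (Fin n) (Fin n) ℂ) (u : EuclideanSpace ℝ (Fin m)) :
    Matrix (Fin n) (Fin n) ℂ :=
  H0 + ∑ i, (u i : ℂ) • Hc i

/-- `lam u 0 ≤ ⋯ ≤ lam u (n-1)` are the eigenvalues of `H(u)`, repeated according to
their multiplicities, for every `u ∈ U`:  `lam u` is monotone and the characteristic
polynomial of `H(u)` is `∏ j, (X - lam u j)`. -/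
def IsOrderedSpectrum {n m : ℕ} (H0 : Matrix (Fin n) (Fin n) ℂ)
    (Hc : Fin m → Matrix (Fin n) (Fin n) ℂ) (U : Set (EuclideanSpace ℝ (Fin m)))
    (lam : EuclideanSpace ℝ (Fin m) → Fin n → ℝ) : Prop :=
  ∀ u ∈ U, Monotone (lam u) ∧
    (controlHam H0 Hc u).charpoly = ∏ j, (Polynomial.X - Polynomial.C ((lam u j : ℂ)))

/-- The eigenvalue `lam ubar l` is a simple eigenvalue. -/
def SimpleEigAt {n m : ℕ} (lam : EuclideanSpace ℝ (Fin m) → Fin n → ℝ)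
    (ubar : EuclideanSpace ℝ (Fin m)) (l : Fin n) : Prop :=
  ∀ l' : Fin n, lam ubar l' = lam ubar l → l' = l

/-- `ubar ∈ U` is a conical intersection between the (consecutive) eigenvalues
`lam · j` and `lam · k`:  they coincide at `ubar`, the common value is an eigenvalue of
multiplicity two, and the gap opens at least linearly in every direction. -/
def ConicalAt {n m : ℕ} (U : Set (EuclideanSpace ℝ (Fin m)))
    (lam : EuclideanSpace ℝ (Fin m) → Fin n → ℝ) (j k : Fin n)
    (ubar : EuclideanSpace ℝ (Fin m)) : Prop :=
  ubar ∈ U ∧ lam ubar j = lam ubar k ∧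
  (∀ l : Fin n, lam ubar l = lam ubar j ↔ (l = j ∨ l = k)) ∧
  ∃ c > (0 : ℝ), ∀ v : EuclideanSpace ℝ (Fin m), ‖v‖ = 1 →
    ∃ ε > (0 : ℝ), ∀ t : ℝ, 0 < t → t < ε →
      lam (ubar + t • v) k - lam (ubar + t • v) j > c * t

/-- The spectrum is conically connected: every eigenvalue intersection is conical, and
every pair of subsequent eigenvalues admits a conical intersection at which all the
other eigenvalues are simple. -/
def ConicallyConnected {n m : ℕ} (U : Set (EuclideanSpace ℝ (Fin m)))
    (lam : EuclideanSpace ℝ (Fin m) → Fin n → ℝ) : Prop :=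
  (∀ ubar ∈ U, ∀ j k : Fin n, (j : ℕ) + 1 = (k : ℕ) → lam ubar j = lam ubar k →
    ConicalAt U lam j k ubar) ∧
  (∀ j k : Fin n, (j : ℕ) + 1 = (k : ℕ) → ∃ ubar : EuclideanSpace ℝ (Fin m),
    ConicalAt U lam j k ubar ∧ ∀ l : Fin n, l ≠ j → l ≠ k → SimpleEigAt lam ubar l)

section Helpers
open Matrix Filter Topology

/-- Two monotone families with the same product of linear factors agree. -/
theorem mono_unique {n : ℕ} (f g : Fin n → ℝ) (hf : Monotone f) (hg : Monotone g)
    (h : ∏ j, (Polynomial.X - Polynomial.C ((f j : ℂ))) =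
      ∏ j, (Polynomial.X - Polynomial.C ((g j : ℂ)))) : f = g := by
  have h1 := congrArg Polynomial.roots h
  have hr : ∀ f : Fin n → ℝ, (∏ j, (Polynomial.X - Polynomial.C ((f j : ℂ)))).roots =
      Finset.univ.val.map (fun j => (f j : ℂ)) := by
    intro f
    have := Polynomial.roots_multiset_prod_X_sub_C (Finset.univ.val.map (fun j => (f j : ℂ)))
    rw [Multiset.map_map] at this
    exact this
  rw [hr, hr] at h1
  have h2 : (Finset.univ.val.map f) = (Finset.univ.val.map g) := by
    apply Multiset.map_injective Complex.ofReal_injective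
    rw [Multiset.map_map, Multiset.map_map]
    exact h1
  have h3 : (List.ofFn f).Perm (List.ofFn g) := by
    rw [← Multiset.coe_eq_coe]
    simpa [Fin.univ_val_map] using h2
  have h4 := h3.eq_of_pairwise (le := (· ≤ ·)) (fun a b _ _ h h' => le_antisymm h h')
    hf.sortedLE_ofFn.pairwise hg.sortedLE_ofFn.pairwise
  exact List.ofFn_injective h4

theorem exists_eigenbasis {n : ℕ} (A : Matrix (Fin n) (Fin n) ℂ) (hA : A.IsHermitian)
    (f : Fin n → ℝ) (hf : Monotone f)
    (h : A.charpoly = ∏ j, (Polynomial.X - Polynomial.C ((f j : ℂ)))) :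
    ∃ b : Fin n → Fin n → ℂ, (∀ l l', star (b l) ⬝ᵥ b l' = if l = l' then 1 else 0) ∧
      (∀ l, A *ᵥ b l = (f l : ℂ) • b l) := by
  have h1 : f = hA.eigenvalues ∘ (Tuple.sort hA.eigenvalues) := by
    apply mono_unique _ _ hf (Tuple.monotone_sort _)
    rw [← h, hA.charpoly_eq]
    exact (Equiv.prod_comp (Tuple.sort hA.eigenvalues)
      (fun i => (Polynomial.X - Polynomial.C ((hA.eigenvalues i : ℂ))))).symm
  refine ⟨fun l => (hA.eigenvectorBasis (Tuple.sort hA.eigenvalues l)).ofLp, ?_, ?_⟩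
  · intro l l'
    have := orthonormal_iff_ite.mp hA.eigenvectorBasis.orthonormal
      (Tuple.sort hA.eigenvalues l) (Tuple.sort hA.eigenvalues l')
    rw [EuclideanSpace.inner_eq_star_dotProduct] at this
    rw [dotProduct_comm, this]
    simp
  · intro l
    rw [hA.mulVec_eigenvectorBasis, h1]
    ext i
    simp

theorem eig_abs_le {n : ℕ} (A : Matrix (Fin n) (Fin n) ℂ) (r : ℝ) (x : Fin n → ℂ) (hx : ‖x‖ = 1)
    (h : A *ᵥ x = (r : ℂ) • x) : |r| ≤ ∑ i, ∑ j, ‖A i j‖ := by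
  have h1 : ‖A *ᵥ x‖ = |r| := by rw [h, norm_smul, hx]; simp
  rw [← h1, pi_norm_le_iff_of_nonneg (by positivity)]
  intro i
  calc ‖(A *ᵥ x) i‖ ≤ ∑ j, ‖A i j * x j‖ := by
        simp only [mulVec, dotProduct]
        exact norm_sum_le _ _
    _ ≤ ∑ j, ‖A i j‖ := by
      apply Finset.sum_le_sum
      intro j _
      rw [norm_mul]
      have : ‖x j‖ ≤ 1 := hx ▸ norm_le_pi_norm x j
      nlinarith [norm_nonneg (A i j)]
    _ ≤ _ := Finset.single_le_sum (f := fun i => ∑ j, ‖A i j‖) (fun i _ => by positivity)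
      (Finset.mem_univ i)

theorem exists_unit_eigvec {n : ℕ} (A : Matrix (Fin n) (Fin n) ℂ) (f : Fin n → ℝ)
    (h : A.charpoly = ∏ j, (Polynomial.X - Polynomial.C ((f j : ℂ)))) (j : Fin n) :
    ∃ x : Fin n → ℂ, ‖x‖ = 1 ∧ A *ᵥ x = (f j : ℂ) • x := by
  have h0 : (scalar (Fin n) (f j : ℂ) - A).det = 0 := by
    rw [← Matrix.eval_charpoly, h, Polynomial.eval_prod]
    apply Finset.prod_eq_zero (Finset.mem_univ j)
    simp
  obtain ⟨v, hv, hv'⟩ := Matrix.exists_mulVec_eq_zero_iff.mpr h0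
  have hv2 : A *ᵥ v = (f j : ℂ) • v := by
    rw [sub_mulVec] at hv'
    have := sub_eq_zero.mp hv'
    rw [← this]
    ext i
    simp [scalar_apply, mulVec_diagonal]
  refine ⟨((‖v‖⁻¹ : ℝ) : ℂ) • v, ?_, ?_⟩
  · rw [norm_smul]
    simp [hv]
  · rw [mulVec_smul, hv2, smul_comm]

noncomputable def dirHam {n m : ℕ} (Hc : Fin m → Matrix (Fin n) (Fin n) ℂ)
    (v : EuclideanSpace ℝ (Fin m)) : Matrix (Fin n) (Fin n) ℂ := ∑ i, (v i : ℂ) • Hc i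

theorem dirHam_add {n m : ℕ} (Hc : Fin m → Matrix (Fin n) (Fin n) ℂ)
    (v w : EuclideanSpace ℝ (Fin m)) : dirHam Hc (v + w) = dirHam Hc v + dirHam Hc w := by
  simp [dirHam, add_smul, Finset.sum_add_distrib]

theorem dirHam_smul {n m : ℕ} (Hc : Fin m → Matrix (Fin n) (Fin n) ℂ) (t : ℝ)
    (v : EuclideanSpace ℝ (Fin m)) : dirHam Hc (t • v) = (t : ℂ) • dirHam Hc v := by
  unfold dirHam
  rw [Finset.smul_sum]
  refine Finset.sum_congr rfl fun i _ => ?_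
  rw [smul_smul, ← Complex.ofReal_mul]
  rfl

theorem controlHam_add {n m : ℕ} (H0 : Matrix (Fin n) (Fin n) ℂ)
    (Hc : Fin m → Matrix (Fin n) (Fin n) ℂ) (u v : EuclideanSpace ℝ (Fin m)) :
    controlHam H0 Hc (u + v) = controlHam H0 Hc u + dirHam Hc v := by
  rw [add_comm u v, add_comm (controlHam H0 Hc u)]
  simp only [controlHam]
  change H0 + dirHam Hc (v + u) = dirHam Hc v + (H0 + dirHam Hc u)
  rw [dirHam_add]; abel

theorem dirHam_herm {n m : ℕ} {Hc : Fin m → Matrix (Fin n) (Fin n) ℂ}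
    (hHc : ∀ i, (Hc i).IsHermitian) (v : EuclideanSpace ℝ (Fin m)) :
    (dirHam Hc v).IsHermitian := by
  unfold dirHam Matrix.IsHermitian
  rw [conjTranspose_sum]
  refine Finset.sum_congr rfl fun i _ => ?_
  rw [conjTranspose_smul, (hHc i).eq]
  simp

theorem controlHam_herm {n m : ℕ} {H0 : Matrix (Fin n) (Fin n) ℂ}
    {Hc : Fin m → Matrix (Fin n) (Fin n) ℂ} (hH0 : H0.IsHermitian)
    (hHc : ∀ i, (Hc i).IsHermitian) (v : EuclideanSpace ℝ (Fin m)) :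
    (controlHam H0 Hc v).IsHermitian := hH0.add (dirHam_herm hHc v)

theorem controlHam_continuous {n m : ℕ} (H0 : Matrix (Fin n) (Fin n) ℂ)
    (Hc : Fin m → Matrix (Fin n) (Fin n) ℂ) : Continuous (controlHam H0 Hc) := by
  unfold controlHam
  fun_prop

/-- Sequential continuity of the ordered spectrum. -/
theorem lam_tendsto {n m : ℕ} {U : Set (EuclideanSpace ℝ (Fin m))}
    {H0 : Matrix (Fin n) (Fin n) ℂ} {Hc : Fin m → Matrix (Fin n) (Fin n) ℂ}
    {lam : EuclideanSpace ℝ (Fin m) → Fin n → ℝ}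
    (hlam : IsOrderedSpectrum H0 Hc U lam) (u : ℕ → EuclideanSpace ℝ (Fin m))
    (a : EuclideanSpace ℝ (Fin m)) (hu : ∀ k, u k ∈ U) (ha : a ∈ U)
    (hua : Tendsto u atTop (𝓝 a)) : Tendsto (fun k => lam (u k)) atTop (𝓝 (lam a)) := by
  refine tendsto_of_subseq_tendsto fun ns hns => ?_
  have hH : Tendsto (fun k => controlHam H0 Hc (u k)) atTop (𝓝 (controlHam H0 Hc a)) :=
    ((controlHam_continuous H0 Hc).tendsto a).comp hua
  -- boundedness
  have hB : Continuous (fun v => ∑ i, ∑ j, ‖controlHam H0 Hc v i j‖) := by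
    have := controlHam_continuous H0 Hc
    refine continuous_finsetSum _ fun i _ => continuous_finsetSum _ fun j _ => ?_
    exact (this.matrix_elem i j).norm
  obtain ⟨R, hR⟩ := ((hB.tendsto a).comp hua).bddAbove_range
  have hmem : ∀ k, lam (u (ns k)) ∈ Metric.closedBall (0 : Fin n → ℝ) (max R 0) := by
    intro k
    rw [mem_closedBall_zero_iff, pi_norm_le_iff_of_nonneg (le_max_right _ _)]
    intro j
    obtain ⟨x, hx, hx'⟩ := exists_unit_eigvec _ _ (hlam _ (hu (ns k))).2 j
    refine (eig_abs_le _ _ x hx hx').trans (le_trans ?_ (le_max_left _ _))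
    exact hR ⟨ns k, rfl⟩
  obtain ⟨l, -, φ, hφ, hl⟩ := (isCompact_closedBall _ _).tendsto_subseq hmem
  refine ⟨φ, ?_⟩
  have hn2 : Tendsto (fun k => ns (φ k)) atTop atTop := hns.comp hφ.tendsto_atTop
  have hl' : ∀ j, Tendsto (fun k => lam (u (ns (φ k))) j) atTop (𝓝 (l j)) :=
    fun j => (tendsto_pi_nhds.mp hl) j
  have hmono : Monotone l := fun i j hij =>
    le_of_tendsto_of_tendsto' (hl' i) (hl' j) (fun k => (hlam _ (hu _)).1 hij)
  have : l = lam a := by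
    apply mono_unique _ _ hmono (hlam a ha).1
    apply Polynomial.funext
    intro z
    rw [← (hlam a ha).2, Matrix.eval_charpoly]
    have h1 : Tendsto (fun k => (scalar (Fin n) z - controlHam H0 Hc (u (ns (φ k)))).det) atTop
        (𝓝 ((scalar (Fin n) z - controlHam H0 Hc a).det)) := by
      have hc : Continuous (fun v => (scalar (Fin n) z - controlHam H0 Hc v).det) :=
        (continuous_const.sub (controlHam_continuous H0 Hc)).matrix_det
      exact ((hc.tendsto a).comp hua).comp hn2
    have h2 : Tendsto (fun k => (scalar (Fin n) z - controlHam H0 Hc (u (ns (φ k)))).det) atTop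
        (𝓝 (∏ j, (z - (l j : ℂ)))) := by
      have : ∀ k, (scalar (Fin n) z - controlHam H0 Hc (u (ns (φ k)))).det =
          ∏ j, (z - (lam (u (ns (φ k))) j : ℂ)) := by
        intro k
        rw [← Matrix.eval_charpoly, (hlam _ (hu _)).2, Polynomial.eval_prod]
        simp
      simp_rw [this]
      refine tendsto_finsetProd _ fun j _ => ?_
      exact tendsto_const_nhds.sub ((Complex.continuous_ofReal.tendsto _).comp (hl' j))
    rw [tendsto_nhds_unique h1 h2, Polynomial.eval_prod]
    simp
  rw [← this]
  exact hl

theorem self_dot_ne {n : ℕ} {x : Fin n → ℂ} (hx : x ≠ 0) : star x ⬝ᵥ x ≠ 0 := by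
  intro h
  apply hx
  have h2 : ∑ i, Complex.normSq (x i) = 0 := by
    have h3 : ((∑ i, Complex.normSq (x i) : ℝ) : ℂ) = 0 := by
      rw [← h]
      simp [dotProduct, Complex.normSq_eq_conj_mul_self]
    exact_mod_cast h3
  rw [Finset.sum_eq_zero_iff_of_nonneg (fun i _ => Complex.normSq_nonneg _)] at h2
  ext i
  simpa using h2 i (Finset.mem_univ i)

/-- First order perturbation: if the compression of `B` to the eigenspace of `A` for `r` is the
scalar `μ`, then eigenvalues of `A + t B` converging to `r` have slope `μ`. -/
theorem slope_tendsto {n : ℕ} (A B : Matrix (Fin n) (Fin n) ℂ) (hA : A.IsHermitian) (r μ : ℝ)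
    (hE : ∀ x : Fin n → ℂ, A *ᵥ x = (r : ℂ) • x → star x ⬝ᵥ (B *ᵥ x) = (μ : ℂ) * (star x ⬝ᵥ x))
    (t s : ℕ → ℝ) (ht : ∀ k, 0 < t k) (ht0 : Tendsto t atTop (𝓝 0))
    (hs : Tendsto s atTop (𝓝 r))
    (hev : ∀ k, ∃ x : Fin n → ℂ, ‖x‖ = 1 ∧ (A + (t k : ℂ) • B) *ᵥ x = (s k : ℂ) • x) :
    Tendsto (fun k => (s k - r) / t k) atTop (𝓝 μ) := by
  choose x hx1 hx2 using hev
  refine tendsto_of_subseq_tendsto fun ns hns => ?_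
  have hmem : ∀ k, x (ns k) ∈ Metric.sphere (0 : Fin n → ℂ) 1 := by
    intro k; simp [hx1]
  obtain ⟨y, hy, φ, hφ, hl⟩ := (isCompact_sphere _ _).tendsto_subseq hmem
  refine ⟨φ, ?_⟩
  have hn2 : Tendsto (fun k => ns (φ k)) atTop atTop := hns.comp hφ.tendsto_atTop
  have hy0 : y ≠ 0 := by
    rintro rfl; simp at hy
  have hxl : Tendsto (fun k => x (ns (φ k))) atTop (𝓝 y) := hl
  have htl : Tendsto (fun k => (t (ns (φ k)) : ℂ)) atTop (𝓝 0) := by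
    have := (Complex.continuous_ofReal.tendsto 0).comp (ht0.comp hn2)
    rw [Complex.ofReal_zero] at this
    exact this
  have hsl : Tendsto (fun k => (s (ns (φ k)) : ℂ)) atTop (𝓝 (r : ℂ)) :=
    (Complex.continuous_ofReal.tendsto r).comp (hs.comp hn2)
  have hmv : ∀ C : Matrix (Fin n) (Fin n) ℂ, Tendsto (fun k => C *ᵥ x (ns (φ k))) atTop
      (𝓝 (C *ᵥ y)) := fun C =>
    ((continuous_const.matrix_mulVec continuous_id).tendsto y).comp hxl
  have hAy : A *ᵥ y = (r : ℂ) • y := by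
    have h1 : Tendsto (fun k => (s (ns (φ k)) : ℂ) • x (ns (φ k))) atTop (𝓝 ((r : ℂ) • y)) :=
      hsl.smul hxl
    have h2 : Tendsto (fun k => (s (ns (φ k)) : ℂ) • x (ns (φ k))) atTop
        (𝓝 (A *ᵥ y + (0 : ℂ) • (B *ᵥ y))) := by
      simp_rw [← hx2, add_mulVec, smul_mulVec]
      exact (hmv A).add (htl.smul (hmv B))
    rw [tendsto_nhds_unique h1 h2]; simp
  have hdot : ∀ {f : ℕ → Fin n → ℂ} {z : Fin n → ℂ}, Tendsto f atTop (𝓝 z) →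
      Tendsto (fun k => star y ⬝ᵥ f k) atTop (𝓝 (star y ⬝ᵥ z)) := fun h =>
    ((continuous_const.dotProduct continuous_id).tendsto _).comp h
  have hkey : ∀ k, (((s (ns (φ k)) - r) / t (ns (φ k)) : ℝ) : ℂ) * (star y ⬝ᵥ x (ns (φ k)))
      = star y ⬝ᵥ (B *ᵥ x (ns (φ k))) := by
    intro k
    have h1 := congrArg (fun w => star y ⬝ᵥ w) (hx2 (ns (φ k)))
    simp only [add_mulVec, smul_mulVec, dotProduct_add, dotProduct_smul] at h1
    have h2 : star y ⬝ᵥ (A *ᵥ x (ns (φ k))) = (r : ℂ) * (star y ⬝ᵥ x (ns (φ k))) := by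
      rw [dotProduct_mulVec]
      have : star y ᵥ* A = (r : ℂ) • star y := by
        have h3 := congrArg star hAy
        rw [star_mulVec, hA.eq] at h3
        rw [h3]; ext i; simp
      rw [this, smul_dotProduct]; rfl
    rw [h2] at h1
    have ht' : (t (ns (φ k)) : ℂ) ≠ 0 := by exact_mod_cast (ht _).ne'
    push_cast
    field_simp
    simp only [smul_eq_mul] at h1
    linear_combination -h1
  have hlim : Tendsto (fun k => (((s (ns (φ k)) - r) / t (ns (φ k)) : ℝ) : ℂ)) atTop
      (𝓝 (μ : ℂ)) := by
    have h1 : Tendsto (fun k => (star y ⬝ᵥ (B *ᵥ x (ns (φ k)))) / (star y ⬝ᵥ x (ns (φ k)))) atTop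
        (𝓝 ((star y ⬝ᵥ (B *ᵥ y)) / (star y ⬝ᵥ y))) :=
      (hdot (hmv B)).div (hdot hxl) (self_dot_ne hy0)
    rw [hE y hAy, mul_div_cancel_right₀ _ (self_dot_ne hy0)] at h1
    refine h1.congr' ?_
    filter_upwards [(hdot hxl).eventually_ne (self_dot_ne hy0)] with k hk
    rw [← hkey k, mul_div_cancel_right₀ _ hk]
  have := (Complex.continuous_re.tendsto _).comp hlim
  exact this

/-- At a conical intersection no nonzero direction has scalar compression. -/
theorem conical_not_scalar {n m : ℕ} {U : Set (EuclideanSpace ℝ (Fin m))} (hU : IsOpen U)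
    {H0 : Matrix (Fin n) (Fin n) ℂ} {Hc : Fin m → Matrix (Fin n) (Fin n) ℂ}
    (hH0 : H0.IsHermitian) (hHc : ∀ i, (Hc i).IsHermitian)
    {lam : EuclideanSpace ℝ (Fin m) → Fin n → ℝ}
    (hlam : IsOrderedSpectrum H0 Hc U lam) {j k : Fin n} {a : EuclideanSpace ℝ (Fin m)}
    (hc : ConicalAt U lam j k a) (v : EuclideanSpace ℝ (Fin m)) (μ : ℝ)
    (hE : ∀ x : Fin n → ℂ, controlHam H0 Hc a *ᵥ x = (lam a j : ℂ) • x →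
      star x ⬝ᵥ (dirHam Hc v *ᵥ x) = (μ : ℂ) * (star x ⬝ᵥ x)) : v = 0 := by
  by_contra hv
  obtain ⟨haU, hjk, -, c, hc0, hgap⟩ := hc
  have hvn : 0 < ‖v‖ := norm_pos_iff.mpr hv
  obtain ⟨ε, hε, hgap⟩ := hgap (‖v‖⁻¹ • v) (by rw [norm_smul]; simp [hv])
  have hseq : ∀ᶠ k : ℕ in atTop, a + (1 / ((k : ℝ) + 1)) • v ∈ U ∧ ‖v‖ * (1 / ((k : ℝ) + 1)) < ε := by
    have h0 : Tendsto (fun k : ℕ => 1 / ((k : ℝ) + 1)) atTop (𝓝 0) :=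
      tendsto_one_div_add_atTop_nhds_zero_nat
    refine Eventually.and ?_ ?_
    · have : Tendsto (fun k : ℕ => a + (1 / ((k : ℝ) + 1)) • v) atTop (𝓝 a) := by
        simpa using tendsto_const_nhds.add (h0.smul_const v)
      exact this (hU.mem_nhds haU)
    · have : Tendsto (fun k : ℕ => ‖v‖ * (1 / ((k : ℝ) + 1))) atTop (𝓝 0) := by
        simpa using h0.const_mul ‖v‖
      exact this.eventually (gt_mem_nhds hε)
  obtain ⟨N, hN⟩ := eventually_atTop.mp hseq
  set t : ℕ → ℝ := fun k => 1 / (((k + N : ℕ) : ℝ) + 1) with ht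
  have htpos : ∀ k, 0 < t k := fun k => by rw [ht]; positivity
  have ht0 : Tendsto t atTop (𝓝 0) :=
    (tendsto_one_div_add_atTop_nhds_zero_nat (𝕜 := ℝ)).comp (tendsto_add_atTop_nat N)
  have hmem : ∀ k, a + t k • v ∈ U := fun k => (hN (k + N) (by omega)).1
  have hlim : Tendsto (fun k => a + t k • v) atTop (𝓝 a) := by
    simpa using tendsto_const_nhds.add (ht0.smul_const v)
  have hlt := tendsto_pi_nhds.mp (lam_tendsto hlam _ a hmem haU hlim)
  have hsl : ∀ l, lam a l = lam a j →
      Tendsto (fun k => (lam (a + t k • v) l - lam a j) / t k) atTop (𝓝 μ) := by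
    intro l hl
    refine slope_tendsto _ (dirHam Hc v) (controlHam_herm hH0 hHc a) (lam a j) μ hE t _ htpos ht0
      (hl ▸ hlt l) ?_
    intro k
    obtain ⟨x, hx, hx'⟩ := exists_unit_eigvec _ _ (hlam _ (hmem k)).2 l
    refine ⟨x, hx, ?_⟩
    rw [← hx', controlHam_add, dirHam_smul]
  have h1 := (hsl k hjk.symm).sub (hsl j rfl)
  have h2 : c * ‖v‖ ≤ μ - μ := by
    refine ge_of_tendsto' h1 fun i => ?_
    have h3 := hgap (‖v‖ * t i) (mul_pos hvn (htpos i)) (hN (i + N) (by omega)).2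
    have h4 : (‖v‖ * t i) • ‖v‖⁻¹ • v = t i • v := by
      rw [smul_smul]; congr 1; field_simp
    rw [h4] at h3
    rw [← sub_div, le_div_iff₀ (htpos i)]
    linarith
  nlinarith

theorem expand_onb {n : ℕ} (b : Fin n → Fin n → ℂ)
    (hb : ∀ l l', star (b l) ⬝ᵥ b l' = if l = l' then 1 else 0) :
    ∑ l, vecMulVec (b l) (star (b l)) = 1 := by
  have h1 : (Matrix.of fun l i => star (b l i)) * (Matrix.of fun i l => b l i) = 1 := by
    ext l l'
    rw [Matrix.mul_apply, Matrix.one_apply, ← hb l l']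
    rfl
  have h2 := mul_eq_one_comm.mp h1
  rw [← h2]
  ext i j
  simp [Matrix.sum_apply, vecMulVec_apply, Matrix.mul_apply]

theorem expand_vec {n : ℕ} (b : Fin n → Fin n → ℂ)
    (hb : ∀ l l', star (b l) ⬝ᵥ b l' = if l = l' then 1 else 0) (x : Fin n → ℂ) :
    x = ∑ l, (star (b l) ⬝ᵥ x) • b l := by
  have h := congrArg (fun M => M *ᵥ x) (expand_onb b hb)
  simp only [one_mulVec, sum_mulVec, vecMulVec_mulVec] at h
  conv_lhs => rw [← h]
  simp

theorem herm_dot {n : ℕ} {A : Matrix (Fin n) (Fin n) ℂ} (hA : A.IsHermitian) (x y : Fin n → ℂ) :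
    star x ⬝ᵥ (A *ᵥ y) = star (A *ᵥ x) ⬝ᵥ y := by
  rw [dotProduct_mulVec, star_mulVec, hA.eq]

theorem dot_conj {n : ℕ} (x y : Fin n → ℂ) : star (star x ⬝ᵥ y) = star y ⬝ᵥ x := by
  exact (star_dotProduct y x).symm

theorem eig_coef {n : ℕ} {A : Matrix (Fin n) (Fin n) ℂ} (hA : A.IsHermitian) {x y : Fin n → ℂ}
    {r s : ℝ} (hx : A *ᵥ x = (r : ℂ) • x) (hy : A *ᵥ y = (s : ℂ) • y) (hrs : r ≠ s) :
    star x ⬝ᵥ y = 0 := by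
  have h := herm_dot hA x y
  rw [hx, hy, dotProduct_smul, star_smul, smul_dotProduct] at h
  simp only [smul_eq_mul, Complex.star_def, Complex.conj_ofReal] at h
  have h2 : ((r : ℂ) - s) * (star x ⬝ᵥ y) = 0 := by linear_combination -h
  rcases mul_eq_zero.mp h2 with h3 | h3
  · exact absurd (by exact_mod_cast sub_eq_zero.mp h3) hrs
  · exact h3

theorem herm_quot {n : ℕ} {A : Matrix (Fin n) (Fin n) ℂ} (hA : A.IsHermitian) {x : Fin n → ℂ}
    (hx : x ≠ 0) :
    (((star x ⬝ᵥ (A *ᵥ x)) / (star x ⬝ᵥ x)).re : ℂ) * (star x ⬝ᵥ x) = star x ⬝ᵥ (A *ᵥ x) := by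
  have h : ((((star x ⬝ᵥ (A *ᵥ x)) / (star x ⬝ᵥ x)).re : ℝ) : ℂ) =
      (star x ⬝ᵥ (A *ᵥ x)) / (star x ⬝ᵥ x) := by
    rw [← Complex.conj_eq_iff_re, map_div₀]
    have h1 := dot_conj x (A *ᵥ x)
    have h2 := dot_conj x x
    simp only [Complex.star_def] at h1 h2
    rw [h1, h2, herm_dot hA]
  rw [h, div_mul_cancel₀ _ (self_dot_ne hx)]

theorem exists_ker {m : ℕ} (hm : 2 ≤ m) (f : EuclideanSpace ℝ (Fin m) →ₗ[ℝ] ℝ) :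
    ∃ v, v ≠ 0 ∧ f v = 0 := by
  have h : LinearMap.ker f ≠ ⊥ := by
    apply LinearMap.ker_ne_bot_of_finrank_lt
    simp; omega
  obtain ⟨v, hv, hv0⟩ := Submodule.exists_mem_ne_zero_of_ne_bot h
  exact ⟨v, hv0, hv⟩

/-- A multiple eigenvalue does not split along an invariant subspace. -/
theorem no_split {n m : ℕ} (hm : 2 ≤ m) {U : Set (EuclideanSpace ℝ (Fin m))} (hU : IsOpen U)
    {H0 : Matrix (Fin n) (Fin n) ℂ} {Hc : Fin m → Matrix (Fin n) (Fin n) ℂ}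
    (hH0 : H0.IsHermitian) (hHc : ∀ i, (Hc i).IsHermitian)
    {lam : EuclideanSpace ℝ (Fin m) → Fin n → ℝ}
    (hlam : IsOrderedSpectrum H0 Hc U lam) (hcc : ConicallyConnected U lam)
    {a : EuclideanSpace ℝ (Fin m)} (ha : a ∈ U) (r : ℝ) (x y : Fin n → ℂ)
    (hx0 : x ≠ 0) (hy0 : y ≠ 0) (hxy : star x ⬝ᵥ y = 0)
    (hxe : controlHam H0 Hc a *ᵥ x = (r : ℂ) • x) (hye : controlHam H0 Hc a *ᵥ y = (r : ℂ) • y)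
    (hd : ∀ v, star x ⬝ᵥ (dirHam Hc v *ᵥ y) = 0) : False := by
  have hA := controlHam_herm hH0 hHc a
  obtain ⟨b, hb, hbe⟩ := exists_eigenbasis _ hA _ (hlam a ha).1 (hlam a ha).2
  have hco : ∀ {e : Fin n → ℂ}, controlHam H0 Hc a *ᵥ e = (r : ℂ) • e → ∀ l, lam a l ≠ r →
      star (b l) ⬝ᵥ e = 0 := fun he l hl => eig_coef hA (hbe l) he hl
  have hex : ∀ {e : Fin n → ℂ}, e ≠ 0 → controlHam H0 Hc a *ᵥ e = (r : ℂ) • e →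
      ∃ l, lam a l = r := by
    intro e he0 he
    by_contra! hcon
    apply he0
    rw [expand_vec b hb e]
    exact Finset.sum_eq_zero fun l _ => by rw [hco he l (hcon l), zero_smul]
  have hone : ∀ {e : Fin n → ℂ} {l : Fin n}, (∀ l', lam a l' = r → l' = l) →
      controlHam H0 Hc a *ᵥ e = (r : ℂ) • e → e = (star (b l) ⬝ᵥ e) • b l := by
    intro e l h he
    conv_lhs => rw [expand_vec b hb e]
    refine Finset.sum_eq_single l (fun l' _ hl' => ?_) (by simp)
    rw [hco he l' (fun h' => hl' (h l' h')), zero_smul]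
  -- two indices
  obtain ⟨l1, l2, hlt, hl1, hl2⟩ : ∃ l1 l2 : Fin n, l1 < l2 ∧ lam a l1 = r ∧ lam a l2 = r := by
    obtain ⟨l, hl⟩ := hex hx0 hxe
    by_cases hu : ∀ l', lam a l' = r → l' = l
    · exfalso
      have h1 := hone hu hxe
      have h2 := hone hu hye
      have hbl : star (b l) ⬝ᵥ b l = 1 := by simp [hb]
      rw [h1, h2, star_smul, smul_dotProduct, dotProduct_smul, hbl] at hxy
      simp only [smul_eq_mul, mul_one, mul_eq_zero, star_eq_zero] at hxy
      rcases hxy with h | h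
      · rw [h, zero_smul] at h1; exact hx0 h1
      · rw [h, zero_smul] at h2; exact hy0 h2
    · push Not at hu
      obtain ⟨l', hl', hne⟩ := hu
      rcases lt_or_gt_of_ne hne with h | h
      · exact ⟨l', l, h, hl', hl⟩
      · exact ⟨l, l', h, hl, hl'⟩
  have hk : (l1 : ℕ) + 1 < n := by
    have := l2.2
    have : (l1 : ℕ) < l2 := hlt
    omega
  set k : Fin n := ⟨l1 + 1, hk⟩ with hkdef
  have hlk : lam a k = r := by
    have hmono := (hlam a ha).1
    apply le_antisymm
    · rw [← hl2]; exact hmono (by rw [Fin.le_def]; exact hlt)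
    · rw [← hl1]; exact hmono (by rw [Fin.le_def]; simp [hkdef])
  have hcon := hcc.1 a ha l1 k (by simp [hkdef]) (by rw [hl1, hlk])
  have hset := hcon.2.2.1
  have hE : ∀ e : Fin n → ℂ, controlHam H0 Hc a *ᵥ e = (r : ℂ) • e →
      e ∈ Submodule.span ℂ (Set.range ![b l1, b k]) := by
    intro e he
    rw [expand_vec b hb e]
    refine Submodule.sum_mem _ fun l _ => ?_
    by_cases hl : lam a l = r
    · rcases (hset l).mp (by rw [hl, hl1]) with h | h
      · rw [h]; exact Submodule.smul_mem _ _ (Submodule.subset_span ⟨0, rfl⟩)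
      · rw [h]; exact Submodule.smul_mem _ _ (Submodule.subset_span ⟨1, rfl⟩)
    · rw [hco he l hl, zero_smul]; exact Submodule.zero_mem _
  have hyx : star y ⬝ᵥ x = 0 := by rw [← dot_conj, hxy, star_zero]
  have hli : LinearIndependent ℂ ![x, y] := by
    rw [LinearIndependent.pair_iff]
    intro s t hst
    have h1 := congrArg (fun w => star x ⬝ᵥ w) hst
    have h2 := congrArg (fun w => star y ⬝ᵥ w) hst
    simp only [dotProduct_add, dotProduct_smul, hxy, hyx, dotProduct_zero, smul_eq_mul,
      mul_zero, add_zero, zero_add] at h1 h2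
    exact ⟨(mul_eq_zero.mp h1).resolve_right (self_dot_ne hx0),
      (mul_eq_zero.mp h2).resolve_right (self_dot_ne hy0)⟩
  have hspan : Submodule.span ℂ (Set.range ![x, y]) =
      Submodule.span ℂ (Set.range ![b l1, b k]) := by
    apply Submodule.eq_of_le_of_finrank_le
    · rw [Submodule.span_le]
      rintro _ ⟨i, rfl⟩
      fin_cases i
      · exact hE x hxe
      · exact hE y hye
    · rw [finrank_span_eq_card hli]
      exact finrank_range_le_card _
  have hE2 : ∀ e : Fin n → ℂ, controlHam H0 Hc a *ᵥ e = (r : ℂ) • e →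
      ∃ α β : ℂ, α • x + β • y = e := by
    intro e he
    have := hE e he
    rw [← hspan, Matrix.range_cons, Matrix.range_cons, Matrix.range_empty, Set.union_empty,
      Set.singleton_union, Submodule.mem_span_pair] at this
    exact this
  let f : EuclideanSpace ℝ (Fin m) →ₗ[ℝ] ℝ :=
    { toFun := fun v => ((star x ⬝ᵥ (dirHam Hc v *ᵥ x)) / (star x ⬝ᵥ x)).re -
        ((star y ⬝ᵥ (dirHam Hc v *ᵥ y)) / (star y ⬝ᵥ y)).re
      map_add' := by
        intro v w
        simp only [dirHam_add, add_mulVec, dotProduct_add, add_div, Complex.add_re]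
        ring
      map_smul' := by
        intro t v
        simp only [dirHam_smul, smul_mulVec, dotProduct_smul, smul_eq_mul, mul_div_assoc,
          Complex.re_ofReal_mul, RingHom.id_apply]
        ring }
  obtain ⟨v, hv0, hv⟩ := exists_ker hm f
  refine hv0 (conical_not_scalar hU hH0 hHc hlam hcon v
    ((star x ⬝ᵥ (dirHam Hc v *ᵥ x)) / (star x ⬝ᵥ x)).re ?_)
  intro e he
  rw [hl1] at he
  obtain ⟨α, β, rfl⟩ := hE2 e he
  have hD := dirHam_herm hHc v
  have hx2 := herm_quot hD hx0
  have hy2 := herm_quot hD hy0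
  have hpq : ((star x ⬝ᵥ (dirHam Hc v *ᵥ x)) / (star x ⬝ᵥ x)).re =
      ((star y ⬝ᵥ (dirHam Hc v *ᵥ y)) / (star y ⬝ᵥ y)).re := sub_eq_zero.mp hv
  rw [← hpq] at hy2
  have hd2 : star y ⬝ᵥ (dirHam Hc v *ᵥ x) = 0 := by
    rw [herm_dot hD, ← dot_conj, hd, star_zero]
  generalize ((star x ⬝ᵥ (dirHam Hc v *ᵥ x)) / (star x ⬝ᵥ x)).re = p at *
  simp only [mulVec_add, mulVec_smul, star_add, star_smul, dotProduct_add, add_dotProduct,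
    smul_dotProduct, dotProduct_smul, hd v, hd2, hxy, hyx, ← hx2, ← hy2, smul_eq_mul]
  ring

theorem mulVec_tendsto {n : ℕ} {A : ℕ → Matrix (Fin n) (Fin n) ℂ} {x : ℕ → Fin n → ℂ}
    {B : Matrix (Fin n) (Fin n) ℂ} {y : Fin n → ℂ} (hA : Tendsto A atTop (𝓝 B))
    (hx : Tendsto x atTop (𝓝 y)) : Tendsto (fun k => A k *ᵥ x k) atTop (𝓝 (B *ᵥ y)) := by
  rw [tendsto_pi_nhds]
  intro i
  simp only [mulVec, dotProduct]
  refine tendsto_finsetSum _ fun j _ => ?_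
  have h1 : Tendsto (fun k => A k i j) atTop (𝓝 (B i j)) :=
    ((continuous_id.matrix_elem i j).tendsto B).comp hA
  exact h1.mul ((tendsto_pi_nhds.mp hx) j)

theorem smul_tendsto {n : ℕ} {s : ℕ → ℝ} {x : ℕ → Fin n → ℂ} {r : ℝ} {y : Fin n → ℂ}
    (hs : Tendsto s atTop (𝓝 r)) (hx : Tendsto x atTop (𝓝 y)) :
    Tendsto (fun k => (s k : ℂ) • x k) atTop (𝓝 ((r : ℂ) • y)) :=
  Tendsto.smul ((Complex.continuous_ofReal.tendsto r).comp hs) hx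

theorem closed_eigset {n m : ℕ} {U : Set (EuclideanSpace ℝ (Fin m))}
    {H0 : Matrix (Fin n) (Fin n) ℂ} {Hc : Fin m → Matrix (Fin n) (Fin n) ℂ}
    {lam : EuclideanSpace ℝ (Fin m) → Fin n → ℝ}
    (hlam : IsOrderedSpectrum H0 Hc U lam) (V : Submodule ℂ (Fin n → ℂ)) (j : Fin n) :
    IsClosed {u : U | ∃ x ∈ V, ‖x‖ = 1 ∧
      controlHam H0 Hc u *ᵥ x = (lam u j : ℂ) • x} := by
  apply IsSeqClosed.isClosed
  intro u a hu hua
  choose x hxV hx1 hx2 using hu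
  have hmem : ∀ k, x k ∈ Metric.sphere (0 : Fin n → ℂ) 1 := by
    intro k; simp [hx1]
  obtain ⟨y, hy, φ, hφ, hl⟩ := (isCompact_sphere _ _).tendsto_subseq hmem
  have hua' : Tendsto (fun k => (u (φ k) : EuclideanSpace ℝ (Fin m))) atTop (𝓝 a) :=
    ((continuous_subtype_val.tendsto a).comp hua).comp hφ.tendsto_atTop
  have hlt := tendsto_pi_nhds.mp
    (lam_tendsto hlam _ a (fun k => (u (φ k)).2) a.2 hua') j
  have hH : Tendsto (fun k => controlHam H0 Hc (u (φ k))) atTop (𝓝 (controlHam H0 Hc a)) :=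
    ((controlHam_continuous H0 Hc).tendsto (a : EuclideanSpace ℝ (Fin m))).comp hua'
  have hl : Tendsto (fun k => x (φ k)) atTop (𝓝 y) := hl
  refine ⟨y, ?_, by simpa using hy, ?_⟩
  · exact V.closed_of_finiteDimensional.mem_of_tendsto hl (Eventually.of_forall fun k => hxV _)
  · have h1 : Tendsto (fun k => controlHam H0 Hc (u (φ k)) *ᵥ x (φ k)) atTop
        (𝓝 (controlHam H0 Hc a *ᵥ y)) :=
      mulVec_tendsto hH hl
    have h2 : Tendsto (fun k => (lam (u (φ k)) j : ℂ) • x (φ k)) atTop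
        (𝓝 ((lam a j : ℂ) • y)) :=
      smul_tendsto hlt hl
    refine tendsto_nhds_unique h1 (h2.congr fun k => ?_)
    exact (hx2 (φ k)).symm

def orthC {n : ℕ} (V : Submodule ℂ (Fin n → ℂ)) : Submodule ℂ (Fin n → ℂ) where
  carrier := {y | ∀ x ∈ V, star x ⬝ᵥ y = 0}
  add_mem' := by
    intro y z hy hz x hx
    rw [dotProduct_add, hy x hx, hz x hx, add_zero]
  zero_mem' := by intro x _; simp
  smul_mem' := by
    intro c y hy x hx
    rw [dotProduct_smul, hy x hx, smul_zero]

theorem exists_decomp {n : ℕ} (V : Submodule ℂ (Fin n → ℂ)) (x : Fin n → ℂ) :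
    ∃ y ∈ V, ∃ z ∈ orthC V, y + z = x := by
  let e := WithLp.linearEquiv 2 ℂ (Fin n → ℂ)
  let K : Submodule ℂ (EuclideanSpace ℂ (Fin n)) := V.comap e.toLinearMap
  obtain ⟨y, hy, z, hz, h⟩ := K.exists_add_mem_mem_orthogonal (WithLp.toLp 2 x)
  refine ⟨y.ofLp, hy, z.ofLp, ?_, ?_⟩
  · intro w hw
    have := (Submodule.mem_orthogonal K z).mp hz (WithLp.toLp 2 w) hw
    rw [EuclideanSpace.inner_eq_star_dotProduct] at this
    rw [dotProduct_comm]; exact this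
  · have := congrArg WithLp.ofLp h
    simpa using this.symm

theorem normalize_eig {n : ℕ} {A : Matrix (Fin n) (Fin n) ℂ} {V : Submodule ℂ (Fin n → ℂ)}
    {x : Fin n → ℂ} {r : ℂ} (hx : x ≠ 0) (hV : x ∈ V) (h : A *ᵥ x = r • x) :
    ∃ x ∈ V, ‖x‖ = 1 ∧ A *ᵥ x = r • x := by
  refine ⟨((‖x‖⁻¹ : ℝ) : ℂ) • x, V.smul_mem _ hV, ?_, ?_⟩
  · rw [norm_smul]; simp [hx]
  · rw [mulVec_smul, h, smul_comm]

/-- Irreducibility. -/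
theorem irreducible {n m : ℕ} (hn : 2 ≤ n) (hm : 2 ≤ m)
    {U : Set (EuclideanSpace ℝ (Fin m))} (hU : IsOpen U) (hUc : IsConnected U)
    {H0 : Matrix (Fin n) (Fin n) ℂ} {Hc : Fin m → Matrix (Fin n) (Fin n) ℂ}
    (hH0 : H0.IsHermitian) (hHc : ∀ i, (Hc i).IsHermitian)
    {lam : EuclideanSpace ℝ (Fin m) → Fin n → ℝ}
    (hlam : IsOrderedSpectrum H0 Hc U lam) (hcc : ConicallyConnected U lam)
    (V : Submodule ℂ (Fin n → ℂ)) (hV0 : V ≠ ⊥)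
    (hVH : ∀ u ∈ U, ∀ x ∈ V, controlHam H0 Hc u *ᵥ x ∈ V)
    (hVd : ∀ v, ∀ x ∈ V, dirHam Hc v *ᵥ x ∈ V) : V = ⊤ := by
  have hWH : ∀ u ∈ U, ∀ x ∈ orthC V, controlHam H0 Hc u *ᵥ x ∈ orthC V := by
    intro u hu x hx y hy
    rw [herm_dot (controlHam_herm hH0 hHc u)]
    exact hx _ (hVH u hu y hy)
  have hdisj : ∀ x ∈ V, x ∈ orthC V → x = 0 := by
    intro x hx hx'
    by_contra h
    exact self_dot_ne h (hx' x hx)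
  let S : Submodule ℂ (Fin n → ℂ) → Fin n → Set U := fun V j => {u : U | ∃ x ∈ V, ‖x‖ = 1 ∧
      controlHam H0 Hc u *ᵥ x = (lam u j : ℂ) • x}
  have hne : ∀ x : Fin n → ℂ, ‖x‖ = 1 → x ≠ 0 := by
    rintro x hx rfl; simp at hx
  -- disjointness
  have hST : ∀ (u : U) (i j : Fin n), lam u i = lam u j → u ∈ S V i → u ∈ S (orthC V) j → False := by
    rintro u i j hij ⟨x, hx, hx1, hxe⟩ ⟨y, hy, hy1, hye⟩
    refine no_split hm hU hH0 hHc hlam hcc u.2 (lam u j) x y (hne _ hx1) (hne _ hy1) (hy x hx)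
      (hij ▸ hxe) hye ?_
    intro v
    rw [herm_dot (dirHam_herm hHc v)]
    exact hy _ (hVd v x hx)
  -- covering
  have hcov : ∀ (u : U) (j : Fin n), u ∈ S V j ∨ u ∈ S (orthC V) j := by
    intro u j
    obtain ⟨x, hx1, hxe⟩ := exists_unit_eigvec _ _ (hlam u u.2).2 j
    obtain ⟨y, hy, z, hz, rfl⟩ := exists_decomp V x
    have h1 : controlHam H0 Hc u *ᵥ y - (lam u j : ℂ) • y =
        -(controlHam H0 Hc u *ᵥ z - (lam u j : ℂ) • z) := by
      rw [mulVec_add, smul_add] at hxe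
      linear_combination (exp := 1) hxe
    have h2 : controlHam H0 Hc u *ᵥ y - (lam u j : ℂ) • y = 0 := by
      apply hdisj
      · exact V.sub_mem (hVH u u.2 y hy) (V.smul_mem _ hy)
      · rw [h1]
        exact (orthC V).neg_mem ((orthC V).sub_mem (hWH u u.2 z hz) ((orthC V).smul_mem _ hz))
    have h3 : controlHam H0 Hc u *ᵥ z - (lam u j : ℂ) • z = 0 := by
      rw [h2] at h1
      exact neg_eq_zero.mp h1.symm
    by_cases hy0 : y = 0
    · right
      refine normalize_eig ?_ hz (sub_eq_zero.mp h3)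
      rintro rfl
      rw [hy0] at hx1
      simp at hx1
    · left
      exact normalize_eig hy0 hy (sub_eq_zero.mp h2)
  have hclopen : ∀ j, S V j = ∅ ∨ S V j = Set.univ := by
    intro j
    have : PreconnectedSpace U := isPreconnected_iff_preconnectedSpace.mp hUc.isPreconnected
    refine isClopen_iff.mp ⟨closed_eigset hlam V j, ?_⟩
    have : S V j = (S (orthC V) j)ᶜ := by
      ext u
      constructor
      · intro h h'; exact hST u j j rfl h h'
      · intro h; exact (hcov u j).resolve_right h
    rw [this]
    exact (closed_eigset hlam (orthC V) j).isOpen_compl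
  have hstep : ∀ j k : Fin n, (j : ℕ) + 1 = k → (S V j = Set.univ ↔ S V k = Set.univ) := by
    intro j k hjk
    obtain ⟨a, ⟨ha, hajk, -⟩, -⟩ := hcc.2 j k hjk
    have : (⟨a, ha⟩ : U) ∈ S V j ↔ (⟨a, ha⟩ : U) ∈ S V k := by
      simp only [S, Set.mem_ofPred_eq, hajk]
    rcases hclopen j with h | h <;> rcases hclopen k with h' | h' <;> simp_all
  have hall : ∀ (i : ℕ) (hi : i < n), (S V ⟨i, hi⟩ = Set.univ ↔ S V ⟨0, by omega⟩ = Set.univ) := by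
    intro i
    induction i with
    | zero => intro hi; rfl
    | succ i ih =>
      intro hi
      rw [← ih (by omega)]
      exact (hstep ⟨i, by omega⟩ ⟨i + 1, hi⟩ rfl).symm
  obtain ⟨a, ha⟩ := hUc.nonempty
  -- eigenvectors in the invariant subspaces
  obtain ⟨b, hb, hbe⟩ := exists_eigenbasis _ (controlHam_herm hH0 hHc a) _ (hlam a ha).1
    (hlam a ha).2
  have hfin : ∀ W W' : Submodule ℂ (Fin n → ℂ), (∀ x, ∃ y ∈ W, ∃ z ∈ W', y + z = x) →
      (∀ x ∈ W, x ∈ W' → x = 0) →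
      (∀ x ∈ W, controlHam H0 Hc a *ᵥ x ∈ W) → (∀ x ∈ W', controlHam H0 Hc a *ᵥ x ∈ W') →
      (∀ j, (⟨a, ha⟩ : U) ∉ S W' j) → W = ⊤ := by
    intro W W' hdec hdis hW hW' hS
    rw [eq_top_iff]
    rintro x -
    rw [expand_vec b hb x]
    refine W.sum_mem fun l _ => W.smul_mem _ ?_
    obtain ⟨y, hy, z, hz, hyz⟩ := hdec (b l)
    have hbl := hbe l
    rw [← hyz, mulVec_add, smul_add] at hbl
    have h1 : controlHam H0 Hc a *ᵥ z - (lam a l : ℂ) • z =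
        -(controlHam H0 Hc a *ᵥ y - (lam a l : ℂ) • y) := by
      linear_combination (exp := 1) hbl
    have h2 : controlHam H0 Hc a *ᵥ z - (lam a l : ℂ) • z = 0 := by
      apply hdis
      · rw [h1]
        exact W.neg_mem (W.sub_mem (hW y hy) (W.smul_mem _ hy))
      · exact W'.sub_mem (hW' z hz) (W'.smul_mem _ hz)
    by_cases hz0 : z = 0
    · rw [← hyz, hz0, add_zero]; exact hy
    · exact absurd (normalize_eig hz0 hz (sub_eq_zero.mp h2)) (hS l)
  by_cases h0 : S V ⟨0, by omega⟩ = Set.univ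
  · refine hfin V (orthC V) (exists_decomp V) hdisj (hVH a ha) (hWH a ha) ?_
    intro j hj
    have : S V j = Set.univ := (hall j j.2).mpr h0
    exact hST ⟨a, ha⟩ j j rfl (this ▸ Set.mem_univ _) hj
  · exfalso
    have hT : orthC V = ⊤ := by
      refine hfin (orthC V) V ?_ (fun x h h' => hdisj x h' h) (hWH a ha) (hVH a ha) ?_
      · intro x
        obtain ⟨y, hy, z, hz, h⟩ := exists_decomp V x
        exact ⟨z, hz, y, hy, by rw [add_comm, h]⟩
      · intro j hj
        have : S V j ≠ Set.univ := fun h => h0 ((hall j j.2).mp h)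
        rcases hclopen j with h | h
        · rw [h] at hj; exact hj
        · exact this h
    apply hV0
    rw [eq_bot_iff]
    intro x hx
    exact (Submodule.mem_bot ℂ).mpr (hdisj x hx (hT ▸ Submodule.mem_top))

/-- Rank one operator `x yᴴ`. -/
def op {n : ℕ} (x y : Fin n → ℂ) : Matrix (Fin n) (Fin n) ℂ := vecMulVec x (star y)

theorem op_mul_op {n : ℕ} (x y z w : Fin n → ℂ) : op x y * op z w = (star y ⬝ᵥ z) • op x w := by
  rw [op, op, vecMulVec_mul_vecMulVec, vecMulVec_smul]; rfl

theorem mul_op {n : ℕ} (A : Matrix (Fin n) (Fin n) ℂ) (x y : Fin n → ℂ) :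
    A * op x y = op (A *ᵥ x) y := mul_vecMulVec _ _ _

theorem op_mul {n : ℕ} (A : Matrix (Fin n) (Fin n) ℂ) (x y : Fin n → ℂ) :
    op x y * A = op x (Aᴴ *ᵥ y) := by
  rw [op, op, vecMulVec_mul, star_mulVec, conjTranspose_conjTranspose]

theorem op_star {n : ℕ} (x y : Fin n → ℂ) : (op x y)ᴴ = op y x := by
  rw [op, conjTranspose_vecMulVec, star_star]; rfl

theorem op_mulVec {n : ℕ} (x y z : Fin n → ℂ) : op x y *ᵥ z = (star y ⬝ᵥ z) • x := by
  rw [op, vecMulVec_mulVec]; simp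

theorem op_add {n : ℕ} (x y z : Fin n → ℂ) : op (x + y) z = op x z + op y z := add_vecMulVec _ _ _

theorem op_smul {n : ℕ} (c : ℂ) (x z : Fin n → ℂ) : op (c • x) z = c • op x z := smul_vecMulVec _ _ _

theorem op_sub {n : ℕ} (x y z : Fin n → ℂ) : op (x - y) z = op x z - op y z := sub_vecMulVec _ _ _

theorem op_add' {n : ℕ} (x y z : Fin n → ℂ) : op x (y + z) = op x y + op x z := by
  rw [op, star_add, vecMulVec_add]; rfl

theorem op_smul' {n : ℕ} (c : ℂ) (x z : Fin n → ℂ) : op x (c • z) = star c • op x z := by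
  rw [op, star_smul, vecMulVec_smul]; rfl

/-- Functional calculus inside an invariant subspace. -/
theorem diag_calc {X : Type*} [AddCommGroup X] [Module ℂ X] (M : Submodule ℂ X) (f : X →ₗ[ℂ] X)
    (hf : ∀ x ∈ M, f x ∈ M) {ι : Type*} [Fintype ι] (a : ι → X) (c : ι → ℂ)
    (h : ∀ i, f (a i) = c i • a i) (hsum : ∑ i, a i ∈ M) (g : ℂ → ℂ) :
    ∑ i, g (c i) • a i ∈ M := by
  classical
  set p := Lagrange.interpolate (Finset.univ.image c) id g with hp
  have hpc : ∀ i, p.eval (c i) = g (c i) := by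
    intro i
    exact Lagrange.eval_interpolate_at_node (v := id) g (Function.injective_id.injOn)
      (Finset.mem_image_of_mem c (Finset.mem_univ i))
  have hpow : ∀ (k : ℕ) (x : X), x ∈ M → (f ^ k) x ∈ M := by
    intro k
    induction k with
    | zero => intro x hx; simpa using hx
    | succ k ih => intro x hx; rw [pow_succ]; exact ih _ (hf x hx)
  have hpow2 : ∀ (k : ℕ) (i : ι), (f ^ k) (a i) = (c i) ^ k • a i := by
    intro k i
    induction k with
    | zero => simp
    | succ k ih =>
      rw [pow_succ, Module.End.mul_apply, h, map_smul, ih, smul_smul, pow_succ, mul_comm]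
  have h1 : Polynomial.aeval f p (∑ i, a i) = ∑ i, g (c i) • a i := by
    rw [map_sum]
    refine Finset.sum_congr rfl fun i _ => ?_
    rw [← hpc i, Polynomial.aeval_eq_sum_range, Polynomial.eval_eq_sum_range, LinearMap.sum_apply,
      Finset.sum_smul]
    refine Finset.sum_congr rfl fun k _ => ?_
    rw [LinearMap.smul_apply, hpow2, smul_smul]
  rw [← h1, Polynomial.aeval_eq_sum_range, LinearMap.sum_apply]
  exact M.sum_mem fun k _ => by
    rw [LinearMap.smul_apply]; exact M.smul_mem _ (hpow k _ hsum)

theorem weight_calc {n : ℕ} (M : Submodule ℂ (Matrix (Fin n) (Fin n) ℂ))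
    (hbr : ∀ A ∈ M, ∀ B ∈ M, A * B - B * A ∈ M) (b : Fin n → Fin n → ℂ)
    (hb : ∀ l l', star (b l) ⬝ᵥ b l' = if l = l' then 1 else 0)
    (D : Matrix (Fin n) (Fin n) ℂ) (hD : D ∈ M) (hDh : D.IsHermitian) (μ : Fin n → ℝ)
    (hDb : ∀ l, D *ᵥ b l = (μ l : ℂ) • b l) (A : Matrix (Fin n) (Fin n) ℂ) (hA : A ∈ M)
    (g : ℝ → ℂ) : ∃ B ∈ M, ∀ l l',
      star (b l) ⬝ᵥ (B *ᵥ b l') = g (μ l - μ l') * (star (b l) ⬝ᵥ (A *ᵥ b l')) := by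
  let f : Matrix (Fin n) (Fin n) ℂ →ₗ[ℂ] Matrix (Fin n) (Fin n) ℂ :=
    LinearMap.mulLeft ℂ D - LinearMap.mulRight ℂ D
  have hA2 : A = ∑ p : Fin n × Fin n, (star (b p.1) ⬝ᵥ (A *ᵥ b p.2)) • op (b p.1) (b p.2) := by
    have h1 := expand_onb b hb
    calc A = 1 * A * 1 := by simp
      _ = (∑ l, op (b l) (b l)) * A * (∑ l, op (b l) (b l)) := by
        have : ∑ l, op (b l) (b l) = 1 := h1
        rw [this]
      _ = _ := by
        rw [Fintype.sum_prod_type, Finset.sum_mul, Finset.sum_mul]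
        refine Finset.sum_congr rfl fun l _ => ?_
        rw [Finset.mul_sum]
        refine Finset.sum_congr rfl fun l' _ => ?_
        rw [mul_assoc, mul_op, op_mul_op]
  have := diag_calc M f (fun x hx => hbr D hD x hx)
    (fun p : Fin n × Fin n => (star (b p.1) ⬝ᵥ (A *ᵥ b p.2)) • op (b p.1) (b p.2))
    (fun p => ((μ p.1 - μ p.2 : ℝ) : ℂ)) ?_ (hA2 ▸ hA) (fun z => g z.re)
  · refine ⟨_, this, ?_⟩
    intro l l'
    rw [sum_mulVec, dotProduct_sum, Finset.sum_eq_single (l, l')]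
    · simp [smul_mulVec, op_mulVec, hb]
    · rintro ⟨k, k'⟩ - hne
      simp only [smul_mulVec, op_mulVec, hb, dotProduct_smul]
      by_cases h1 : k' = l'
      · have h2 : l ≠ k := by rintro rfl; exact hne (by rw [h1])
        simp [h2]
      · simp [h1]
    · simp
  · rintro ⟨l, l'⟩
    simp only [f, LinearMap.sub_apply, LinearMap.mulLeft_apply, LinearMap.mulRight_apply,
      Matrix.mul_smul, Matrix.smul_mul, mul_op, op_mul, hDh.eq, hDb, op_smul, op_smul',
      Complex.star_def, Complex.conj_ofReal, Complex.ofReal_sub]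
    module

theorem ext_onb {n : ℕ} (b : Fin n → Fin n → ℂ)
    (hb : ∀ l l', star (b l) ⬝ᵥ b l' = if l = l' then 1 else 0)
    (A B : Matrix (Fin n) (Fin n) ℂ) (h : ∀ l, A *ᵥ b l = B *ᵥ b l) : A = B := by
  have h1 : ∀ C : Matrix (Fin n) (Fin n) ℂ, C = ∑ l, op (C *ᵥ b l) (b l) := by
    intro C
    conv_lhs => rw [← mul_one C, ← expand_onb b hb, Finset.mul_sum]
    exact Finset.sum_congr rfl fun l _ => mul_op _ _ _
  rw [h1 A, h1 B]
  exact Finset.sum_congr rfl fun l _ => by rw [h]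

theorem sl2_mem {n : ℕ} (M : Submodule ℂ (Matrix (Fin n) (Fin n) ℂ))
    (hbr : ∀ A ∈ M, ∀ B ∈ M, A * B - B * A ∈ M) (b : Fin n → Fin n → ℂ)
    (hb : ∀ l l', star (b l) ⬝ᵥ b l' = if l = l' then 1 else 0) (i j : Fin n) (hij : i ≠ j)
    (A A' : Matrix (Fin n) (Fin n) ℂ) (hA : A ∈ M) (hA' : A' ∈ M) (p q q' : ℂ) (p' r' : ℝ)
    (α α' : Fin n → ℂ)
    (hAi : A *ᵥ b i = p • b i + star q • b j) (hAj : A *ᵥ b j = q • b i + p • b j)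
    (hAl : ∀ l, l ≠ i → l ≠ j → A *ᵥ b l = α l • b l)
    (hAi' : A' *ᵥ b i = (p' : ℂ) • b i + star q' • b j)
    (hAj' : A' *ᵥ b j = q' • b i + (r' : ℂ) • b j)
    (hAl' : ∀ l, l ≠ i → l ≠ j → A' *ᵥ b l = α' l • b l)
    (hq : q ≠ 0) (hne : (q * star q').im ≠ 0 ∨ p' ≠ r') : op (b i) (b j) ∈ M ∧ op (b j) (b i) ∈ M := by
  have hji : j ≠ i := hij.symm
  set σ := op (b i) (b i) - op (b j) (b j) with hσ
  set K := q • op (b i) (b j) - star q • op (b j) (b i) with hK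
  set S := q • op (b i) (b j) + star q • op (b j) (b i) with hS
  set τ : ℂ := q * star q' - q' * star q with hτ
  set s : ℂ := (p' : ℂ) - r' with hs
  have hcomm : ∀ B C : Matrix (Fin n) (Fin n) ℂ, ∀ x,
      (B * C - C * B) *ᵥ x = B *ᵥ (C *ᵥ x) - C *ᵥ (B *ᵥ x) := by
    intro B C x; rw [sub_mulVec, mulVec_mulVec, mulVec_mulVec]
  have key : ∀ B C : Matrix (Fin n) (Fin n) ℂ, B *ᵥ b i = C *ᵥ b i → B *ᵥ b j = C *ᵥ b j →
      (∀ l, l ≠ i → l ≠ j → B *ᵥ b l = C *ᵥ b l) → B = C := by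
    intro B C h1 h2 h3
    apply ext_onb b hb
    intro l
    by_cases hi : l = i
    · rw [hi]; exact h1
    by_cases hj : l = j
    · rw [hj]; exact h2
    exact h3 l hi hj
  have σi : σ *ᵥ b i = b i := by simp [hσ, sub_mulVec, op_mulVec, hb, hji]
  have σj : σ *ᵥ b j = - b j := by simp [hσ, sub_mulVec, op_mulVec, hb, hij]
  have σl : ∀ l, l ≠ i → l ≠ j → σ *ᵥ b l = 0 := by
    intro l h1 h2; simp [hσ, sub_mulVec, op_mulVec, hb, h1.symm, h2.symm]
  have Ki : K *ᵥ b i = - star q • b j := by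
    simp [hK, sub_mulVec, smul_mulVec, op_mulVec, hb, hji]
  have Kj : K *ᵥ b j = q • b i := by simp [hK, sub_mulVec, smul_mulVec, op_mulVec, hb, hij]
  have Kl : ∀ l, l ≠ i → l ≠ j → K *ᵥ b l = 0 := by
    intro l h1 h2; simp [hK, sub_mulVec, smul_mulVec, op_mulVec, hb, h1.symm, h2.symm]
  have hW : A * A' - A' * A = τ • σ - s • K := by
    apply key
    · rw [hcomm, sub_mulVec, smul_mulVec, smul_mulVec, σi, Ki]
      simp only [hAi, hAi', mulVec_add, mulVec_smul, hAj, hAj', hτ, hs]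
      module
    · rw [hcomm, sub_mulVec, smul_mulVec, smul_mulVec, σj, Kj]
      simp only [hAi, hAi', mulVec_add, mulVec_smul, hAj, hAj', hτ, hs]
      module
    · intro l h1 h2
      rw [hcomm, sub_mulVec, smul_mulVec, smul_mulVec, σl l h1 h2, Kl l h1 h2]
      simp only [hAl l h1 h2, hAl' l h1 h2, mulVec_smul]
      module
  have hAσ : σ * A - A * σ = (2 : ℂ) • K := by
    apply key
    · rw [hcomm, smul_mulVec, σi, Ki, hAi, mulVec_add, mulVec_smul, mulVec_smul, σi, σj]
      module
    · rw [hcomm, smul_mulVec, σj, Kj, hAj, mulVec_add, mulVec_smul, mulVec_smul, σi, σj,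
        mulVec_neg, hAj]
      module
    · intro l h1 h2
      rw [hcomm, smul_mulVec, σl l h1 h2, Kl l h1 h2, hAl l h1 h2, mulVec_smul, σl l h1 h2]
      simp
  have hAK : A * K - K * A = (-2 * (q * star q)) • σ := by
    apply key
    · rw [hcomm, smul_mulVec, σi, Ki, hAi, mulVec_add, mulVec_smul, mulVec_smul, mulVec_smul,
        Ki, Kj, hAj]
      module
    · rw [hcomm, smul_mulVec, σj, Kj, hAj, mulVec_add, mulVec_smul, mulVec_smul, mulVec_smul,
        Ki, Kj, hAi]
      module
    · intro l h1 h2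
      rw [hcomm, smul_mulVec, σl l h1 h2, Kl l h1 h2, hAl l h1 h2, mulVec_smul, Kl l h1 h2]
      simp
  have hσK : σ * K - K * σ = (2 : ℂ) • S := by
    have hSd : S = q • op (b i) (b j) + star q • op (b j) (b i) := hS
    apply key
    · rw [hcomm, smul_mulVec, σi, Ki, mulVec_smul, σj, hSd]
      simp only [add_mulVec, smul_mulVec, op_mulVec, hb, hji, if_true, if_false]
      module
    · rw [hcomm, smul_mulVec, σj, Kj, mulVec_smul, σi, mulVec_neg, Kj, hSd]
      simp only [add_mulVec, smul_mulVec, op_mulVec, hb, hij, if_true, if_false]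
      module
    · intro l h1 h2
      rw [hcomm, smul_mulVec, σl l h1 h2, Kl l h1 h2, hSd]
      simp [add_mulVec, smul_mulVec, op_mulVec, hb, h1.symm, h2.symm]
  have hWM : τ • σ - s • K ∈ M := hW ▸ hbr A hA A' hA'
  have hW2 : A * (τ • σ - s • K) - (τ • σ - s • K) * A =
      (2 * s * (q * star q)) • σ - (2 * τ) • K := by
    have : A * (τ • σ - s • K) - (τ • σ - s • K) * A =
        -(τ • (σ * A - A * σ)) - s • (A * K - K * A) := by
      simp only [mul_sub, sub_mul, Matrix.mul_smul, Matrix.smul_mul, smul_sub]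
      abel
    rw [this, hAσ, hAK]
    module
  have hW2M : (2 * s * (q * star q)) • σ - (2 * τ) • K ∈ M := hW2 ▸ hbr A hA _ hWM
  set Δ : ℂ := τ ^ 2 - s ^ 2 * (q * star q) with hΔ
  have hΔ0 : Δ ≠ 0 := by
    have hτ2 : τ = ((2 * (q * star q').im : ℝ) : ℂ) * Complex.I := by
      apply Complex.ext
      · simp [hτ]; ring
      · simp [hτ]; ring
    have hqq : q * star q = ((Complex.normSq q : ℝ) : ℂ) := Complex.mul_conj q
    have h1 : Δ = ((-((2 * (q * star q').im) ^ 2 + (p' - r') ^ 2 * Complex.normSq q) : ℝ) : ℂ) := by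
      rw [hΔ, hτ2, hqq, hs, mul_pow, Complex.I_sq]
      push_cast
      ring
    rw [h1]
    have hqp : 0 < Complex.normSq q := Complex.normSq_pos.mpr hq
    have : 0 < (2 * (q * star q').im) ^ 2 + (p' - r') ^ 2 * Complex.normSq q := by
      rcases hne with h | h
      · have := pow_pos (abs_pos.mpr h) 2
        rw [sq_abs] at this
        have := mul_nonneg (sq_nonneg (p' - r')) hqp.le
        nlinarith
      · have := mul_pos (pow_pos (abs_pos.mpr (sub_ne_zero.mpr h)) 2) hqp
        rw [sq_abs] at this
        nlinarith [sq_nonneg (q * star q').im]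
    exact_mod_cast (neg_neg_of_pos this).ne
  have hσM : σ ∈ M := by
    have h1 : Δ • σ ∈ M := by
      have h2 := M.sub_mem (M.smul_mem τ hWM) (M.smul_mem (s / 2) hW2M)
      convert h2 using 1
      rw [hΔ]
      module
    exact (M.smul_mem_iff hΔ0).mp h1
  have hKM : K ∈ M := by
    have := hbr σ hσM A hA
    rw [hAσ] at this
    exact (M.smul_mem_iff two_ne_zero).mp this
  have hSM : S ∈ M := by
    have := hbr σ hσM K hKM
    rw [hσK] at this
    exact (M.smul_mem_iff two_ne_zero).mp this
  constructor
  · have h1 : (2 * q) • op (b i) (b j) ∈ M := by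
      have := M.add_mem hSM hKM
      convert this using 1
      rw [hS, hK]; module
    exact (M.smul_mem_iff (by simpa using hq)).mp h1
  · have h1 : (2 * star q) • op (b j) (b i) ∈ M := by
      have := M.sub_mem hSM hKM
      convert this using 1
      rw [hS, hK]; module
    exact (M.smul_mem_iff (by simpa using hq)).mp h1

/-- The good subspace attached to `x0`. -/
def goodF {n : ℕ} (M : Submodule ℂ (Matrix (Fin n) (Fin n) ℂ)) (x0 : Fin n → ℂ) :
    Submodule ℂ (Fin n → ℂ) where
  carrier := {f | op f x0 - (star x0 ⬝ᵥ f) • op x0 x0 ∈ M}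
  add_mem' := by
    intro f g hf hg
    have := M.add_mem hf hg
    change op (f + g) x0 - (star x0 ⬝ᵥ (f + g)) • op x0 x0 ∈ M
    convert this using 1
    rw [op_add, dotProduct_add]; module
  zero_mem' := by
    change op 0 x0 - (star x0 ⬝ᵥ 0) • op x0 x0 ∈ M
    simp [op]
  smul_mem' := by
    intro c f hf
    have := M.smul_mem c hf
    change op (c • f) x0 - (star x0 ⬝ᵥ (c • f)) • op x0 x0 ∈ M
    convert this using 1
    rw [op_smul, dotProduct_smul, smul_eq_mul]; module

theorem goodF_aux {n : ℕ} (M : Submodule ℂ (Matrix (Fin n) (Fin n) ℂ))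
    (hbr : ∀ A ∈ M, ∀ B ∈ M, A * B - B * A ∈ M) (hst : ∀ A ∈ M, Aᴴ ∈ M)
    (x0 : Fin n → ℂ) (h0 : star x0 ⬝ᵥ x0 = 1) (x y : Fin n → ℂ) (hx : star x0 ⬝ᵥ x = 0)
    (hy : star x0 ⬝ᵥ y = 0) (hyy : star y ⬝ᵥ y = 1) (hyx : star y ⬝ᵥ x = 0)
    (hxM : op x x0 ∈ M) (hyM : op y x0 ∈ M) (A : Matrix (Fin n) (Fin n) ℂ) (hA : A ∈ M) :
    A *ᵥ x ∈ goodF M x0 := by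
  have hyM' : op x0 y ∈ M := by have := hst _ hyM; rwa [op_star] at this
  have hxy : op x y ∈ M := by
    have := hbr _ hxM _ hyM'
    rw [op_mul_op, op_mul_op, h0, hyx] at this
    simpa using this
  have hyd : op y y - op x0 x0 ∈ M := by
    have := hbr _ hyM _ hyM'
    rw [op_mul_op, op_mul_op, h0, hyy] at this
    simpa using this
  have h1 := hbr _ hA _ hxy
  rw [mul_op, op_mul] at h1
  have h2 := hbr _ h1 _ hyM
  simp only [sub_mul, mul_sub, op_mul_op, hyy, hx] at h2
  have h3 := M.add_mem (M.add_mem h2 (M.smul_mem (star x0 ⬝ᵥ (A *ᵥ x)) hyd))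
    (M.smul_mem (star (Aᴴ *ᵥ y) ⬝ᵥ y) hxM)
  change op (A *ᵥ x) x0 - (star x0 ⬝ᵥ (A *ᵥ x)) • op x0 x0 ∈ M
  convert h3 using 1
  module

theorem goodF_aux0 {n : ℕ} (M : Submodule ℂ (Matrix (Fin n) (Fin n) ℂ))
    (hbr : ∀ A ∈ M, ∀ B ∈ M, A * B - B * A ∈ M) (hst : ∀ A ∈ M, Aᴴ ∈ M)
    (x0 : Fin n → ℂ) (h0 : star x0 ⬝ᵥ x0 = 1) (w y : Fin n → ℂ) (hw : star x0 ⬝ᵥ w = 0)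
    (hy : star x0 ⬝ᵥ y = 0) (hyy : star y ⬝ᵥ y = 1) (hww : star w ⬝ᵥ w = 1)
    (hyw : star y ⬝ᵥ w = 0)
    (hwM : op w x0 ∈ M) (hyM : op y x0 ∈ M) (A : Matrix (Fin n) (Fin n) ℂ) (hA : A ∈ M) :
    A *ᵥ x0 ∈ goodF M x0 := by
  have hyM' : op x0 y ∈ M := by have := hst _ hyM; rwa [op_star] at this
  have hwM' : op x0 w ∈ M := by have := hst _ hwM; rwa [op_star] at this
  have hw' : star w ⬝ᵥ x0 = 0 := by rw [← dot_conj, hw, star_zero]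
  have hwy : star w ⬝ᵥ y = 0 := by rw [← dot_conj, hyw, star_zero]
  have hywM : op y w ∈ M := by
    have := hbr _ hyM _ hwM'
    rw [op_mul_op, op_mul_op, h0, hwy] at this
    simpa using this
  have hwd : op w w - op x0 x0 ∈ M := by
    have := hbr _ hwM _ hwM'
    rw [op_mul_op, op_mul_op, h0, hww] at this
    simpa using this
  have h1 := hbr _ hA _ hyM'
  rw [mul_op, op_mul] at h1
  have h2 := hbr _ h1 _ hywM
  simp only [sub_mul, mul_sub, op_mul_op, hyy, hw'] at h2
  have h3 := M.add_mem h2 (M.smul_mem (star (Aᴴ *ᵥ y) ⬝ᵥ y) hwM')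
  have h4 : op (A *ᵥ x0) w - (star w ⬝ᵥ (A *ᵥ x0)) • op y y ∈ M := by
    convert h3 using 1
    module
  have h5 := hbr _ h4 _ hwM
  simp only [sub_mul, mul_sub, op_mul_op, Matrix.smul_mul, Matrix.mul_smul, hww, hy, hyw] at h5
  have h6 := M.add_mem h5 (M.smul_mem (star x0 ⬝ᵥ (A *ᵥ x0)) hwd)
  change op (A *ᵥ x0) x0 - (star x0 ⬝ᵥ (A *ᵥ x0)) • op x0 x0 ∈ M
  convert h6 using 1
  module

theorem goodF_inv {n : ℕ} (M : Submodule ℂ (Matrix (Fin n) (Fin n) ℂ))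
    (hbr : ∀ A ∈ M, ∀ B ∈ M, A * B - B * A ∈ M) (hst : ∀ A ∈ M, Aᴴ ∈ M)
    (x0 : Fin n → ℂ) (h0 : star x0 ⬝ᵥ x0 = 1) (w y : Fin n → ℂ) (hw : star x0 ⬝ᵥ w = 0)
    (hy : star x0 ⬝ᵥ y = 0) (hyy : star y ⬝ᵥ y = 1) (hww : star w ⬝ᵥ w = 1)
    (hyw : star y ⬝ᵥ w = 0)
    (hwM : op w x0 ∈ M) (hyM : op y x0 ∈ M) (A : Matrix (Fin n) (Fin n) ℂ) (hA : A ∈ M)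
    (f : Fin n → ℂ) (hf : f ∈ goodF M x0) : A *ᵥ f ∈ goodF M x0 := by
  have hwy : star w ⬝ᵥ y = 0 := by rw [← dot_conj, hyw, star_zero]
  set z := f - (star x0 ⬝ᵥ f) • x0 with hz
  have hzM : op z x0 ∈ M := by
    rw [hz, op_sub, op_smul]; exact hf
  have hz0 : star x0 ⬝ᵥ z = 0 := by
    rw [hz, dotProduct_sub, dotProduct_smul, h0]; simp
  set z' := z - (star y ⬝ᵥ z) • y with hz'
  have hz'M : op z' x0 ∈ M := by
    rw [hz', op_sub, op_smul]; exact M.sub_mem hzM (M.smul_mem _ hyM)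
  have hz'0 : star x0 ⬝ᵥ z' = 0 := by
    rw [hz', dotProduct_sub, dotProduct_smul, hz0, hy]; simp
  have hz'y : star y ⬝ᵥ z' = 0 := by
    rw [hz', dotProduct_sub, dotProduct_smul, hyy]; simp
  have hf2 : f = (star x0 ⬝ᵥ f) • x0 + (z' + (star y ⬝ᵥ z) • y) := by
    rw [hz', hz]; abel
  rw [hf2, mulVec_add, mulVec_add, mulVec_smul, mulVec_smul]
  refine Submodule.add_mem _ (Submodule.smul_mem _ _ ?_)
    (Submodule.add_mem _ ?_ (Submodule.smul_mem _ _ ?_))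
  · exact goodF_aux0 M hbr hst x0 h0 w y hw hy hyy hww hyw hwM hyM A hA
  · exact goodF_aux M hbr hst x0 h0 z' y hz'0 hy hyy hz'y hz'M hyM A hA
  · exact goodF_aux M hbr hst x0 h0 y w hy hw hww hwy hyM hwM A hA

theorem sl_of_goodF {n : ℕ} (hn : 2 ≤ n) (M : Submodule ℂ (Matrix (Fin n) (Fin n) ℂ))
    (hbr : ∀ A ∈ M, ∀ B ∈ M, A * B - B * A ∈ M) (hst : ∀ A ∈ M, Aᴴ ∈ M)
    (x0 : Fin n → ℂ) (h0 : star x0 ⬝ᵥ x0 = 1) (hF : goodF M x0 = ⊤)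
    (A : Matrix (Fin n) (Fin n) ℂ) (hA : A.trace = 0) : A ∈ M := by
  have hor : ∀ f g : Fin n → ℂ, op f g - (star g ⬝ᵥ f) • op x0 x0 ∈ M := by
    intro f g
    have hd : ∀ f, ∃ z, f = (star x0 ⬝ᵥ f) • x0 + z ∧ star x0 ⬝ᵥ z = 0 ∧ op z x0 ∈ M := by
      intro f
      have hf : f ∈ goodF M x0 := hF ▸ Submodule.mem_top
      refine ⟨f - (star x0 ⬝ᵥ f) • x0, by abel, ?_, ?_⟩
      · rw [dotProduct_sub, dotProduct_smul, h0]; simp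
      · rw [op_sub, op_smul]; exact hf
    obtain ⟨z, hz, hz0, hzM⟩ := hd f
    obtain ⟨z', hz', hz0', hzM'⟩ := hd g
    have hzM2 := hst _ hzM'
    rw [op_star] at hzM2
    have h1 := hbr _ hzM _ hzM2
    rw [op_mul_op, op_mul_op, h0] at h1
    have hz02 : star z' ⬝ᵥ x0 = 0 := by rw [← dot_conj, hz0', star_zero]
    have h2 := M.add_mem (M.add_mem h1 (M.smul_mem (star x0 ⬝ᵥ f) hzM2))
      (M.smul_mem (star (star x0 ⬝ᵥ g)) hzM)
    generalize star x0 ⬝ᵥ f = α at *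
    generalize star x0 ⬝ᵥ g = β at *
    subst hz hz'
    convert h2 using 1
    simp only [op_add, op_smul, op_add', op_smul', star_add, star_smul, add_dotProduct,
      dotProduct_add, smul_dotProduct, dotProduct_smul, h0, hz0, hz02, smul_eq_mul]
    module
  have hone : ∀ i j : Fin n, single i j (1 : ℂ) = op (Pi.single i 1) (Pi.single j 1) := by
    intro i j
    rw [op, single_eq_single_vecMulVec_single]
    congr 1
    ext k
    by_cases h : k = j <;> simp [Pi.single_apply, h]
  have hA2 : A = ∑ i, ∑ j, A i j • (op (Pi.single i 1) (Pi.single j 1) -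
      (star (Pi.single j 1 : Fin n → ℂ) ⬝ᵥ (Pi.single i 1 : Fin n → ℂ)) • op x0 x0) := by
    have h1 : ∀ i j : Fin n, (star (Pi.single j 1 : Fin n → ℂ) ⬝ᵥ (Pi.single i 1 : Fin n → ℂ)) =
        if i = j then 1 else 0 := by
      intro i j
      simp [Pi.single_apply]
    simp only [h1, smul_sub, Finset.sum_sub_distrib, ← hone]
    have h2 : ∑ i, ∑ j, A i j • (if i = j then (1 : ℂ) else 0) • op x0 x0 = 0 := by
      have : ∀ i, ∑ j, A i j • (if i = j then (1 : ℂ) else 0) • op x0 x0 = A i i • op x0 x0 := by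
        intro i
        rw [Finset.sum_eq_single i] <;> simp +contextual [eq_comm]
      simp only [this, ← Finset.sum_smul]
      have h3 : ∑ i, A i i = 0 := hA
      rw [h3, zero_smul]
    rw [h2, sub_zero]
    conv_lhs => rw [matrix_eq_sum_single A]
    simp [smul_single]
  rw [hA2]
  exact M.sum_mem fun i _ => M.sum_mem fun j _ => M.smul_mem _ (hor _ _)

theorem sl2_of_conical {n m : ℕ} (hm : 2 ≤ m) {U : Set (EuclideanSpace ℝ (Fin m))} (hU : IsOpen U)
    {H0 : Matrix (Fin n) (Fin n) ℂ} {Hc : Fin m → Matrix (Fin n) (Fin n) ℂ}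
    (hH0 : H0.IsHermitian) (hHc : ∀ i, (Hc i).IsHermitian)
    {lam : EuclideanSpace ℝ (Fin m) → Fin n → ℝ}
    (hlam : IsOrderedSpectrum H0 Hc U lam) {j k : Fin n} (hjk : j ≠ k)
    {a : EuclideanSpace ℝ (Fin m)} (hc : ConicalAt U lam j k a)
    (hs : ∀ l : Fin n, l ≠ j → l ≠ k → SimpleEigAt lam a l)
    (M : Submodule ℂ (Matrix (Fin n) (Fin n) ℂ))
    (hbr : ∀ A ∈ M, ∀ B ∈ M, A * B - B * A ∈ M) (hD : controlHam H0 Hc a ∈ M)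
    (hd : ∀ v, dirHam Hc v ∈ M) (b : Fin n → Fin n → ℂ)
    (hb : ∀ l l', star (b l) ⬝ᵥ b l' = if l = l' then 1 else 0)
    (hDb : ∀ l, controlHam H0 Hc a *ᵥ b l = (lam a l : ℂ) • b l) :
    op (b j) (b k) ∈ M ∧ op (b k) (b j) ∈ M := by
  have hDh := controlHam_herm hH0 hHc a
  set e : EuclideanSpace ℝ (Fin m) → Fin n → Fin n → ℂ :=
    fun v l l' => star (b l) ⬝ᵥ (dirHam Hc v *ᵥ b l') with he
  have hest : ∀ v l l', star (e v l l') = e v l' l := by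
    intro v l l'
    simp only [he]
    rw [dot_conj, ← herm_dot (dirHam_herm hHc v)]
  have here : ∀ v l, (((e v l l).re : ℝ) : ℂ) = e v l l := by
    intro v l
    rw [← Complex.conj_eq_iff_re]
    exact hest v l l
  have headd : ∀ v w l l', e (v + w) l l' = e v l l' + e w l l' := by
    intro v w l l'
    simp only [he, dirHam_add, add_mulVec, dotProduct_add]
  have hesm : ∀ (t : ℝ) v l l', e (t • v) l l' = t * e v l l' := by
    intro t v l l'
    simp only [he, dirHam_smul, smul_mulVec, dotProduct_smul, smul_eq_mul]
  have hjj := hc.2.2.1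
  have hkj : lam a k = lam a j := (hjj k).2 (Or.inr rfl)
  have hne : ∀ l, l ≠ j → l ≠ k → lam a l ≠ lam a j := by
    intro l h1 h2 h3
    rcases (hjj l).1 h3 with h | h
    · exact h1 h
    · exact h2 h
  have hcon : ∀ v, e v j k = 0 → (e v j j).re = (e v k k).re → v = 0 := by
    intro v h1 h2
    refine conical_not_scalar hU hH0 hHc hlam hc v (e v j j).re ?_
    intro x hx
    have hx2 : x = (star (b j) ⬝ᵥ x) • b j + (star (b k) ⬝ᵥ x) • b k := by
      conv_lhs => rw [expand_vec b hb x]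
      rw [Finset.sum_eq_add j k hjk]
      · intro l _ hl
        rw [eig_coef hDh (hDb l) hx (hne l hl.1 hl.2), zero_smul]
      · simp
      · simp
    have h3 : e v k j = 0 := by rw [← hest, h1, star_zero]
    have h4 : e v k k = e v j j := by rw [← here, ← here v j, h2]
    rw [here]
    generalize star (b j) ⬝ᵥ x = c at hx2
    generalize star (b k) ⬝ᵥ x = d at hx2
    simp only [he] at h1 h3 h4 ⊢
    rw [hx2]
    simp only [mulVec_add, mulVec_smul, dotProduct_add, add_dotProduct, star_add, star_smul,
      dotProduct_smul, smul_dotProduct, smul_eq_mul, h1, h3, h4, hb, hjk, hjk.symm, if_true, if_false]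
    ring
  have hB : ∀ v, ∃ B ∈ M, B *ᵥ b j = (((e v j j).re : ℝ) : ℂ) • b j + star (e v j k) • b k ∧
      B *ᵥ b k = e v j k • b j + (((e v k k).re : ℝ) : ℂ) • b k ∧
      ∀ l, l ≠ j → l ≠ k → B *ᵥ b l = e v l l • b l := by
    intro v
    obtain ⟨B, hBM, hB⟩ := weight_calc M hbr b hb _ hD hDh (lam a) hDb _ (hd v)
      (fun x => if x = 0 then 1 else 0)
    refine ⟨B, hBM, ?_, ?_, ?_⟩
    · rw [expand_vec b hb (B *ᵥ b j), Finset.sum_eq_add j k hjk]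
      · rw [hB, hB, hkj, here, hest]; simp [he]
      · intro l _ hl
        rw [hB, if_neg (sub_ne_zero.mpr (hne l hl.1 hl.2))]; simp
      · simp
      · simp
    · rw [expand_vec b hb (B *ᵥ b k), Finset.sum_eq_add j k hjk]
      · rw [hB, hB, hkj, here]; simp [he]
      · intro l _ hl
        rw [hB, hkj, if_neg (sub_ne_zero.mpr (hne l hl.1 hl.2))]; simp
      · simp
      · simp
    · intro l h1 h2
      rw [expand_vec b hb (B *ᵥ b l), Finset.sum_eq_single l]
      · rw [hB]; simp [he]
      · intro l' _ hl
        rw [hB, if_neg (sub_ne_zero.mpr fun h => hl (hs l h1 h2 l' h))]; simp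
      · simp
  let s : EuclideanSpace ℝ (Fin m) →ₗ[ℝ] ℝ :=
    { toFun := fun v => (e v j j).re - (e v k k).re
      map_add' := by intro v w; rw [headd, headd, Complex.add_re, Complex.add_re]; ring
      map_smul' := by
        intro t v
        rw [hesm, hesm, Complex.re_ofReal_mul, Complex.re_ofReal_mul]
        simp; ring }
  obtain ⟨v, hv0, hv⟩ := exists_ker hm s
  have hv' : (e v j j).re = (e v k k).re := sub_eq_zero.mp hv
  have hq : e v j k ≠ 0 := fun h => hv0 (hcon v h hv')
  have hw : ∃ w, ∀ r : ℝ, w ≠ r • v := by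
    by_contra! h
    have h1 : Module.finrank ℝ (EuclideanSpace ℝ (Fin m)) ≤ 1 :=
      finrank_le_one v fun w => by obtain ⟨r, hr⟩ := h w; exact ⟨r, hr.symm⟩
    simp at h1
    omega
  obtain ⟨w, hw⟩ := hw
  obtain ⟨A, hA, hA1, hA2, hA3⟩ := hB v
  obtain ⟨A', hA', hA1', hA2', hA3'⟩ := hB w
  rw [← hv'] at hA2
  refine sl2_mem M hbr b hb j k hjk A A' hA hA' _ _ _ _ _ _ _ hA1 hA2 hA3 hA1' hA2' hA3' hq ?_
  by_contra! h
  obtain ⟨h1, h2⟩ := h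
  set q := e v j k with hqd
  set q' := e w j k with hqd'
  set r : ℝ := (q * star q').re / Complex.normSq q with hr
  have hnq : Complex.normSq q ≠ 0 := by simpa using hq
  have hrq : q' = r * q := by
    have h3 : q' * star q = (((q * star q').re : ℝ) : ℂ) := by
      have : q * star q' = (((q * star q').re : ℝ) : ℂ) := by
        apply Complex.ext <;> simp only [Complex.ofReal_re, Complex.ofReal_im, h1]
      have h4 := congrArg star this
      rw [star_mul, star_star] at h4
      rw [h4]; simp
    have h5 : star q * q = (Complex.normSq q : ℂ) := by
      rw [Complex.normSq_eq_conj_mul_self]; rfl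
    have h6 : (Complex.normSq q : ℂ) ≠ 0 := by exact_mod_cast hnq
    rw [hr, Complex.ofReal_div, ← h3, ← h5]
    have h7 : star q ≠ 0 := by simpa using hq
    field_simp
  apply hw r
  have := hcon (w + (-r) • v) (by rw [headd, hesm, ← hqd, ← hqd', hrq]; push_cast; ring) (by
    rw [headd, hesm, headd, hesm, Complex.add_re, Complex.add_re, Complex.re_ofReal_mul,
      Complex.re_ofReal_mul, h2, hv'])
  rw [neg_smul, ← sub_eq_add_neg] at this
  exact sub_eq_zero.mp this

theorem sl_le {n m : ℕ} (hn : 2 ≤ n) (hm : 2 ≤ m)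
    {U : Set (EuclideanSpace ℝ (Fin m))} (hU : IsOpen U) (hUc : IsConnected U)
    {H0 : Matrix (Fin n) (Fin n) ℂ} {Hc : Fin m → Matrix (Fin n) (Fin n) ℂ}
    (hH0 : H0.IsHermitian) (hHc : ∀ i, (Hc i).IsHermitian)
    {lam : EuclideanSpace ℝ (Fin m) → Fin n → ℝ}
    (hlam : IsOrderedSpectrum H0 Hc U lam) (hcc : ConicallyConnected U lam)
    (M : Submodule ℂ (Matrix (Fin n) (Fin n) ℂ))
    (hbr : ∀ A ∈ M, ∀ B ∈ M, A * B - B * A ∈ M) (hst : ∀ A ∈ M, Aᴴ ∈ M)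
    (hD : ∀ u ∈ U, controlHam H0 Hc u ∈ M) (hd : ∀ v, dirHam Hc v ∈ M)
    (A : Matrix (Fin n) (Fin n) ℂ) (hA : A.trace = 0) : A ∈ M := by
  obtain ⟨j, k, hjk⟩ : ∃ j k : Fin n, (j : ℕ) = 0 ∧ (k : ℕ) = 1 :=
    ⟨⟨0, by omega⟩, ⟨1, by omega⟩, rfl, rfl⟩
  have hjk' : j ≠ k := by intro h; rw [h] at hjk; omega
  obtain ⟨a, hc, hs⟩ := hcc.2 j k (by omega)
  have ha := hc.1
  have hDh := controlHam_herm hH0 hHc a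
  obtain ⟨b, hb, hDb⟩ := exists_eigenbasis _ hDh (lam a) (hlam a ha).1 (hlam a ha).2
  obtain ⟨h01, h10⟩ := sl2_of_conical hm hU hH0 hHc hlam hjk' hc hs M hbr (hD a ha) hd b hb hDb
  have hkj : lam a k = lam a j := (hc.2.2.1 k).2 (Or.inr rfl)
  have hgt : ∀ l, l ≠ j → l ≠ k → lam a j < lam a l := by
    intro l h1 h2
    have h3 : lam a j ≤ lam a l := (hlam a ha).1 (by rw [Fin.le_def]; omega)
    refine lt_of_le_of_ne h3 fun h => ?_
    rcases (hc.2.2.1 l).1 h.symm with h | h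
    · exact h1 h
    · exact h2 h
  have h0 : star (b j) ⬝ᵥ b j = 1 := by rw [hb]; simp
  have h1 : star (b k) ⬝ᵥ b k = 1 := by rw [hb]; simp
  have hj0 : b j ≠ 0 := by intro h; rw [h] at h0; simp at h0
  have hojk : star (b j) ⬝ᵥ b k = 0 := by rw [hb, if_neg hjk']
  have hokj : star (b k) ⬝ᵥ b j = 0 := by rw [hb, if_neg hjk'.symm]
  have hgj : b j ∈ goodF M (b j) := by
    change op (b j) (b j) - (star (b j) ⬝ᵥ b j) • op (b j) (b j) ∈ M
    rw [h0, one_smul, sub_self]; exact M.zero_mem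
  have hgk : b k ∈ goodF M (b j) := by
    change op (b k) (b j) - (star (b j) ⬝ᵥ b k) • op (b j) (b j) ∈ M
    rw [hojk, zero_smul, sub_zero]; exact h10
  refine sl_of_goodF hn M hbr hst (b j) h0 ?_ A hA
  by_cases hcase : ∀ B ∈ M, ∀ i, (i = j ∨ i = k) → ∀ l, l ≠ j → l ≠ k →
      star (b l) ⬝ᵥ (B *ᵥ b i) = 0
  · -- the plane is invariant
    let E : Submodule ℂ (Fin n → ℂ) := Submodule.span ℂ {b j, b k}
    have hE : ∀ B ∈ M, ∀ x ∈ E, B *ᵥ x ∈ E := by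
      intro B hB x hx
      have hi : ∀ i, (i = j ∨ i = k) → B *ᵥ b i ∈ E := by
        intro i hi
        rw [expand_vec b hb (B *ᵥ b i)]
        refine E.sum_mem fun l _ => ?_
        by_cases hlj : l = j
        · subst hlj; exact E.smul_mem _ (Submodule.subset_span (by simp))
        by_cases hlk : l = k
        · subst hlk; exact E.smul_mem _ (Submodule.subset_span (by simp))
        rw [hcase B hB i hi l hlj hlk, zero_smul]; exact E.zero_mem
      obtain ⟨c, d, rfl⟩ := Submodule.mem_span_pair.mp hx
      rw [mulVec_add, mulVec_smul, mulVec_smul]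
      exact E.add_mem (E.smul_mem _ (hi j (Or.inl rfl))) (E.smul_mem _ (hi k (Or.inr rfl)))
    have hEtop : E = ⊤ := by
      refine irreducible hn hm hU hUc hH0 hHc hlam hcc E ?_ (fun u hu => hE _ (hD u hu))
        (fun v => hE _ (hd v))
      intro h
      have : b j ∈ E := Submodule.subset_span (by simp)
      rw [h] at this
      exact hj0 ((Submodule.mem_bot ℂ).mp this)
    rw [eq_top_iff, ← hEtop]
    apply Submodule.span_le.mpr
    rintro x (rfl | hx)
    · exact hgj
    · rw [Set.mem_singleton_iff] at hx; rw [hx]; exact hgk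
  · push Not at hcase
    obtain ⟨B, hB, i, hi, l, hlj, hlk, hne⟩ := hcase
    obtain ⟨P, hP, hPm⟩ := weight_calc M hbr b hb _ (hD a ha) hDh (lam a) hDb _ hB
      (fun x => if 0 < x then 1 else 0)
    set z := P *ᵥ b i with hz
    have hli : lam a i = lam a j := by rcases hi with rfl | rfl <;> simp [hkj]
    have hlow : ∀ i', (i' = j ∨ i' = k) → ∀ l', star (b i') ⬝ᵥ (P *ᵥ b l') = 0 := by
      intro i' hi' l'
      have h2 : lam a i' = lam a j := by rcases hi' with rfl | rfl <;> simp [hkj]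
      have h3 : lam a j ≤ lam a l' := (hlam a ha).1 (by rw [Fin.le_def]; omega)
      rw [hPm, if_neg (by linarith), zero_mul]
    have hPst : ∀ i', (i' = j ∨ i' = k) → Pᴴ *ᵥ b i' = 0 := by
      intro i' hi'
      rw [expand_vec b hb (Pᴴ *ᵥ b i')]
      refine Finset.sum_eq_zero fun l' _ => ?_
      have h2 : star (b l') ⬝ᵥ (Pᴴ *ᵥ b i') = 0 := by
        rw [← dot_conj, star_mulVec, conjTranspose_conjTranspose, ← dotProduct_mulVec,
          hlow i' hi' l', star_zero]
      rw [h2, zero_smul]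
    have hzl : star (b l) ⬝ᵥ z ≠ 0 := by
      rw [hz, hPm, if_pos (by rw [hli]; linarith [hgt l hlj hlk]), one_mul]; exact hne
    have hz0 : z ≠ 0 := by intro h; rw [h] at hzl; simp at hzl
    have hzj : star (b j) ⬝ᵥ z = 0 := hlow j (Or.inl rfl) i
    have hzk : star (b k) ⬝ᵥ z = 0 := hlow k (Or.inr rfl) i
    have hopz : ∀ i', (i' = j ∨ i' = k) → op (b i) (b i') ∈ M → op z (b i') ∈ M := by
      intro i' hi' hm'
      have := hbr _ hP _ hm'
      rw [mul_op, op_mul, hPst i' hi'] at this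
      have h2 : op (b i) (0 : Fin n → ℂ) = 0 := by simp [op]
      rwa [h2, sub_zero] at this
    have hzM : op z (b j) ∈ M := by
      rcases hi with hi | hi
      · have h2 := hopz k (Or.inr rfl) (by rw [hi]; exact h01)
        have h3 := hbr _ h2 _ h10
        rw [op_mul_op, op_mul_op, h1, hzj] at h3
        simpa using h3
      · exact hopz j (Or.inl rfl) (by rw [hi]; exact h10)
    obtain ⟨t, ht0, ht⟩ : ∃ t : ℝ, t ≠ 0 ∧ (t : ℂ) * t * (star z ⬝ᵥ z) = 1 := by
      have h2 : star z ⬝ᵥ z = ((∑ i, Complex.normSq (z i) : ℝ) : ℂ) := by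
        simp [dotProduct, Complex.normSq_eq_conj_mul_self]
      have h3 := self_dot_ne hz0
      rw [h2] at h3 ⊢
      have h4 : 0 ≤ ∑ i, Complex.normSq (z i) := Finset.sum_nonneg fun i _ => Complex.normSq_nonneg _
      generalize ∑ i, Complex.normSq (z i) = s at h3 h4
      have h5 : s ≠ 0 := by exact_mod_cast h3
      refine ⟨(Real.sqrt s)⁻¹, inv_ne_zero (Real.sqrt_ne_zero'.mpr (lt_of_le_of_ne h4 h5.symm)), ?_⟩
      have h6 : (Real.sqrt s)⁻¹ * (Real.sqrt s)⁻¹ * s = 1 := by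
        rw [← mul_inv, Real.mul_self_sqrt h4, inv_mul_cancel₀ h5]
      exact_mod_cast h6
    have hinv := goodF_inv M hbr hst (b j) h0 (b k) ((t : ℂ) • z) hojk
      (by rw [dotProduct_smul, hzj, smul_zero])
      (by rw [star_smul, smul_dotProduct, dotProduct_smul, ← ht]; simp [mul_assoc]) h1
      (by rw [star_smul, smul_dotProduct, ← dot_conj, hzk]; simp) h10
      (by rw [op_smul]; exact M.smul_mem _ hzM)
    refine irreducible hn hm hU hUc hH0 hHc hlam hcc _ ?_ (fun u hu => hinv _ (hD u hu))
        (fun v => hinv _ (hd v))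
    intro h
    rw [h] at hgj
    exact hj0 ((Submodule.mem_bot ℂ).mp hgj)

/-- Complexification of a real Lie algebra of matrices. -/
def cplx {n : ℕ} (L : LieSubalgebra ℝ (Matrix (Fin n) (Fin n) ℂ)) :
    Submodule ℂ (Matrix (Fin n) (Fin n) ℂ) where
  carrier := {A | ∃ X ∈ L, ∃ Y ∈ L, A = X + Complex.I • Y}
  add_mem' := by
    rintro _ _ ⟨X, hX, Y, hY, rfl⟩ ⟨X', hX', Y', hY', rfl⟩
    exact ⟨X + X', L.add_mem hX hX', Y + Y', L.add_mem hY hY', by rw [smul_add]; abel⟩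
  zero_mem' := ⟨0, L.zero_mem, 0, L.zero_mem, by simp⟩
  smul_mem' := by
    rintro c _ ⟨X, hX, Y, hY, rfl⟩
    refine ⟨c.re • X - c.im • Y, L.sub_mem (L.smul_mem _ hX) (L.smul_mem _ hY),
      c.im • X + c.re • Y, L.add_mem (L.smul_mem _ hX) (L.smul_mem _ hY), ?_⟩
    ext i j
    apply Complex.ext <;> simp <;> ring

theorem cplx_br {n : ℕ} (L : LieSubalgebra ℝ (Matrix (Fin n) (Fin n) ℂ)) :
    ∀ A ∈ cplx L, ∀ B ∈ cplx L, A * B - B * A ∈ cplx L := by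
  have hl : ∀ X ∈ L, ∀ Y ∈ L, X * Y - Y * X ∈ L := by
    intro X hX Y hY
    have := L.lie_mem hX hY
    rwa [LieRing.of_associative_ring_bracket] at this
  rintro _ ⟨X, hX, Y, hY, rfl⟩ _ ⟨X', hX', Y', hY', rfl⟩
  refine ⟨(X * X' - X' * X) - (Y * Y' - Y' * Y), L.sub_mem (hl _ hX _ hX') (hl _ hY _ hY'),
    (X * Y' - Y' * X) + (Y * X' - X' * Y), L.add_mem (hl _ hX _ hY') (hl _ hY _ hX'), ?_⟩
  have hI : ∀ Z : Matrix (Fin n) (Fin n) ℂ, Complex.I • Complex.I • Z = -Z := by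
    intro Z; rw [smul_smul, Complex.I_mul_I, neg_one_smul]
  simp only [add_mul, mul_add, smul_mul_assoc, mul_smul_comm, hI, smul_add, smul_sub]
  abel

/-- Skew-Hermitian matrices. -/
def skewL (n : ℕ) : LieSubalgebra ℝ (Matrix (Fin n) (Fin n) ℂ) where
  carrier := {A | Aᴴ = -A}
  add_mem' := by
    intro A B hA hB
    change (A + B)ᴴ = -(A + B)
    rw [conjTranspose_add, hA, hB]; abel
  zero_mem' := by simp
  smul_mem' := by
    intro c A hA
    change (c • A)ᴴ = -(c • A)
    rw [conjTranspose_smul, hA]; simp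
  lie_mem' := by
    intro A B hA hB
    change Aᴴ = -A at hA
    change Bᴴ = -B at hB
    change (⁅A, B⁆)ᴴ = -⁅A, B⁆
    rw [LieRing.of_associative_ring_bracket, conjTranspose_sub, conjTranspose_mul,
      conjTranspose_mul, hA, hB]
    simp

/-- Traceless skew-Hermitian matrices. -/
def skewL0 (n : ℕ) : LieSubalgebra ℝ (Matrix (Fin n) (Fin n) ℂ) where
  carrier := {A | Aᴴ = -A ∧ A.trace = 0}
  add_mem' := by
    intro A B hA hB
    exact ⟨(skewL n).add_mem hA.1 hB.1, by rw [trace_add, hA.2, hB.2, add_zero]⟩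
  zero_mem' := by simp
  smul_mem' := by
    intro c A hA
    exact ⟨(skewL n).smul_mem c hA.1, by rw [trace_smul, hA.2, smul_zero]⟩
  lie_mem' := by
    intro A B hA hB
    refine ⟨(skewL n).lie_mem hA.1 hB.1, ?_⟩
    rw [LieRing.of_associative_ring_bracket, trace_sub, trace_mul_comm, sub_self]

theorem main_aux {n m : ℕ} (hn : 2 ≤ n) (hm : 2 ≤ m)
    (U : Set (EuclideanSpace ℝ (Fin m))) (hUopen : IsOpen U) (hUconn : IsConnected U)
    (H0 : Matrix (Fin n) (Fin n) ℂ) (Hc : Fin m → Matrix (Fin n) (Fin n) ℂ)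
    (hH0 : H0.IsHermitian) (hHc : ∀ i, (Hc i).IsHermitian)
    (lam : EuclideanSpace ℝ (Fin m) → Fin n → ℝ)
    (hlam : IsOrderedSpectrum H0 Hc U lam)
    (hcc : ConicallyConnected U lam) :
    ((H0.trace = 0 ∧ ∀ i, (Hc i).trace = 0) →
      (LieSubalgebra.lieSpan ℝ (Matrix (Fin n) (Fin n) ℂ)
          ((fun u => Complex.I • controlHam H0 Hc u) '' U) :
        Set (Matrix (Fin n) (Fin n) ℂ)) = {A | Aᴴ = -A ∧ A.trace = 0}) ∧
    (¬ (H0.trace = 0 ∧ ∀ i, (Hc i).trace = 0) →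
      (LieSubalgebra.lieSpan ℝ (Matrix (Fin n) (Fin n) ℂ)
          ((fun u => Complex.I • controlHam H0 Hc u) '' U) :
        Set (Matrix (Fin n) (Fin n) ℂ)) = {A | Aᴴ = -A}) := by
  set L := LieSubalgebra.lieSpan ℝ (Matrix (Fin n) (Fin n) ℂ)
          ((fun u => Complex.I • controlHam H0 Hc u) '' U) with hL
  have hskI : ∀ A : Matrix (Fin n) (Fin n) ℂ, A.IsHermitian →
      (Complex.I • A)ᴴ = -(Complex.I • A) := by
    intro A hA
    rw [conjTranspose_smul, hA.eq]; simp
  have hLsk : ∀ A ∈ L, Aᴴ = -A := by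
    have : L ≤ skewL n := by
      rw [hL, LieSubalgebra.lieSpan_le]
      rintro _ ⟨u, _, rfl⟩
      exact hskI _ (controlHam_herm hH0 hHc u)
    exact fun A hA => this hA
  have hH : ∀ u ∈ U, Complex.I • controlHam H0 Hc u ∈ L := fun u hu =>
    LieSubalgebra.subset_lieSpan ⟨u, hu, rfl⟩
  obtain ⟨a, ha⟩ := hUconn.nonempty
  have hdir : ∀ v, Complex.I • dirHam Hc v ∈ L := by
    intro v
    have hcont : Tendsto (fun t : ℝ => a + t • v) (𝓝[>] 0) (𝓝 a) := by
      have : Continuous fun t : ℝ => a + t • v := by fun_prop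
      have h2 := this.tendsto 0
      simp only [zero_smul, add_zero] at h2
      exact h2.mono_left nhdsWithin_le_nhds
    obtain ⟨t, htU, ht⟩ := ((hcont.eventually (hUopen.mem_nhds ha)).and
      self_mem_nhdsWithin).exists
    have ht0 : t ≠ 0 := ne_of_gt ht
    have h1 := L.smul_mem t⁻¹ (L.sub_mem (hH _ htU) (hH a ha))
    rw [controlHam_add, dirHam_smul, smul_add, add_sub_cancel_left, smul_comm Complex.I] at h1
    rw [← Complex.coe_smul, smul_smul, ← Complex.ofReal_mul, inv_mul_cancel₀ ht0] at h1
    simpa using h1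
  have hmemC : ∀ A : Matrix (Fin n) (Fin n) ℂ, Complex.I • A ∈ L → A ∈ cplx L := by
    intro A hA
    refine ⟨0, L.zero_mem, -(Complex.I • A), L.neg_mem hA, ?_⟩
    rw [smul_neg, smul_smul, Complex.I_mul_I]; simp
  have hst : ∀ A ∈ cplx L, Aᴴ ∈ cplx L := by
    rintro _ ⟨X, hX, Y, hY, rfl⟩
    refine ⟨-X, L.neg_mem hX, Y, hY, ?_⟩
    rw [conjTranspose_add, conjTranspose_smul, hLsk X hX, hLsk Y hY]
    simp
  have hsl := sl_le hn hm hUopen hUconn hH0 hHc hlam hcc (cplx L) (cplx_br L) hst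
    (fun u hu => hmemC _ (hH u hu)) (fun v => hmemC _ (hdir v))
  have hsu : ∀ A : Matrix (Fin n) (Fin n) ℂ, Aᴴ = -A → A.trace = 0 → A ∈ L := by
    intro A h1 h2
    obtain ⟨X, hX, Y, hY, h3⟩ := hsl A h2
    have h4 : (Complex.I • Y)ᴴ = Complex.I • Y := by
      rw [conjTranspose_smul, hLsk Y hY]; simp
    have h5 : (Complex.I • Y)ᴴ = -(Complex.I • Y) := by
      have : Complex.I • Y = A - X := by rw [h3]; abel
      rw [this, conjTranspose_sub, h1, hLsk X hX]; abel
    have h6 : Complex.I • Y = 0 := by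
      ext i j
      exact self_eq_neg.mp (congrFun (congrFun (h4.symm.trans h5) i) j)
    rw [h3, h6, add_zero]; exact hX
  have hHcL : ∀ i, Complex.I • Hc i ∈ L := by
    intro i
    have h1 := hdir (EuclideanSpace.single i 1)
    have h2 : dirHam Hc (EuclideanSpace.single i 1) = Hc i := by
      unfold dirHam
      rw [Finset.sum_eq_single i]
      · simp
      · intro l _ hl; simp [hl]
      · simp
    rwa [h2] at h1
  have hH0L : Complex.I • H0 ∈ L := by
    have h1 := L.sub_mem (hH a ha) (hdir a)
    have h2 : controlHam H0 Hc a = H0 + dirHam Hc a := rfl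
    rwa [h2, smul_add, add_sub_cancel_right] at h1
  refine ⟨?_, ?_⟩
  · rintro ⟨hT0, hTc⟩
    ext A
    constructor
    · intro hA
      have : L ≤ skewL0 n := by
        rw [hL, LieSubalgebra.lieSpan_le]
        rintro _ ⟨u, _, rfl⟩
        refine ⟨hskI _ (controlHam_herm hH0 hHc u), ?_⟩
        simp [controlHam, trace_sum, hT0, hTc]
      exact this hA
    · rintro ⟨h1, h2⟩
      exact hsu A h1 h2
  · intro hT
    obtain ⟨K, hK, hKL, hKt⟩ : ∃ K : Matrix (Fin n) (Fin n) ℂ, K.IsHermitian ∧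
        Complex.I • K ∈ L ∧ K.trace ≠ 0 := by
      by_cases h : H0.trace = 0
      · have : ∃ i, (Hc i).trace ≠ 0 := by
          by_contra! h2
          exact hT ⟨h, h2⟩
        obtain ⟨i, hi⟩ := this
        exact ⟨Hc i, hHc i, hHcL i, hi⟩
      · exact ⟨H0, hH0, hH0L, h⟩
    ext A
    refine ⟨fun hA => hLsk A hA, fun hA => ?_⟩
    change Aᴴ = -A at hA
    change A ∈ L
    have hKr : ((K.trace.re : ℝ) : ℂ) = K.trace := by
      rw [← Complex.conj_eq_iff_re]
      have := trace_conjTranspose K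
      rw [hK.eq] at this
      exact this.symm
    have hAr : A.trace = Complex.I * ((A.trace.im : ℝ) : ℂ) := by
      have := trace_conjTranspose A
      rw [hA, trace_neg] at this
      have h3 := congrArg Complex.re this
      simp at h3
      apply Complex.ext
      · simp; linarith
      · simp
    set r : ℝ := A.trace.im / K.trace.re with hr
    have hd : A - r • (Complex.I • K) ∈ L := by
      apply hsu
      · have h1 : (A - r • (Complex.I • K)) ∈ skewL n :=
          (skewL n).sub_mem hA ((skewL n).smul_mem r (hskI K hK))
        exact h1
      · have h4 : K.trace.re ≠ 0 := by
          intro h; rw [h] at hKr; exact hKt (by simpa using hKr.symm)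
        have h5 : (r : ℂ) * K.trace = (A.trace.im : ℂ) := by
          rw [← hKr, ← Complex.ofReal_mul, hr, div_mul_cancel₀ _ h4]
        rw [trace_sub, trace_smul, trace_smul, hAr, Complex.real_smul, smul_eq_mul, ← h5]
        ring
    have := L.add_mem hd (L.smul_mem r hKL)
    rwa [sub_add_cancel] at this

end Helpers

open Matrix in
/-- Theorem 2.8 of the paper. If the spectrum of the control-affine
Hamiltonian `H(·)` is conically connected, then the real Lie algebra generated by
`{i·H(u) : u ∈ U}` is `su(n)` when all of `H0, …, Hm` are traceless, and `u(n)`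
otherwise. -/
theorem conically_connected_lie_generating {n m : ℕ} (hn : 2 ≤ n) (hm : 2 ≤ m)
    (U : Set (EuclideanSpace ℝ (Fin m))) (hUopen : IsOpen U) (hUconn : IsConnected U)
    (H0 : Matrix (Fin n) (Fin n) ℂ) (Hc : Fin m → Matrix (Fin n) (Fin n) ℂ)
    (hH0 : H0.IsHermitian) (hHc : ∀ i, (Hc i).IsHermitian)
    (lam : EuclideanSpace ℝ (Fin m) → Fin n → ℝ)
    (hlam : IsOrderedSpectrum H0 Hc U lam)
    (hcc : ConicallyConnected U lam) :
    ((H0.trace = 0 ∧ ∀ i, (Hc i).trace = 0) →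
      (LieSubalgebra.lieSpan ℝ (Matrix (Fin n) (Fin n) ℂ)
          ((fun u => Complex.I • controlHam H0 Hc u) '' U) :
        Set (Matrix (Fin n) (Fin n) ℂ)) = {A | Aᴴ = -A ∧ A.trace = 0}) ∧
    (¬ (H0.trace = 0 ∧ ∀ i, (Hc i).trace = 0) →
      (LieSubalgebra.lieSpan ℝ (Matrix (Fin n) (Fin n) ℂ)
          ((fun u => Complex.I • controlHam H0 Hc u) '' U) :
        Set (Matrix (Fin n) (Fin n) ℂ)) = {A | Aᴴ = -A}) :=
  main_aux hn hm U hUopen hUconn H0 Hc hH0 hHc lam hlam hcc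
end
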